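/- For every τ > 0 there exist τ′ > 0 and a bound p₀ such that the following holds for every prime p ≥ p₀, with G = SL₂(ℤ/pℤ). Let μ : G → ℝ be a probability measure on G (nonnegative with Σ_{g∈G} μ(g) = 1) satisfying max_{x∈G} μ(x) < p^{−τ} and, for every proper subgroup G₁ of G and every a ∈ G, Σ_{x ∈ aG₁} μ(x) < p^{−τ}. Then for every φ : G → ℂ with Σ_{x∈G} φ(x) = 0, one has ‖μ ∗ φ‖₂ ≤ p^{−τ′}·‖φ‖₂. -/

import Mathlib

open Finset
open scoped Classical

/-- Convolution of a real weight with a complex-valued function on a finite group: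
`(μ ∗ φ)(x) = Σ_g μ(g) φ(g⁻¹ x)`. -/
noncomputable def convR {G : Type*} [Group G] [Fintype G] (μ : G → ℝ) (φ : G → ℂ) : G → ℂ :=
  fun x => ∑ g : G, (μ g : ℂ) * φ (g⁻¹ * x)

/-- The `ℓ²` norm `(Σ_x |φ(x)|²)^{1/2}` of a function on a finite group. -/
noncomputable def l2Norm {G : Type*} [Fintype G] (φ : G → ℂ) : ℝ :=
  Real.sqrt (∑ x : G, ‖φ x‖ ^ 2)

namespace L2Flattening

section Convolution

variable {G : Type*} [Group G] [Fintype G]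

/-- The convolution of two real-valued functions on a finite group. -/
noncomputable def conv (f g : G → ℝ) : G → ℝ := fun x => ∑ y, f y * g (y⁻¹ * x)

lemma conv_inv_mul (f g : G → ℝ) (a b : G) :
    conv f g (a⁻¹ * b) = ∑ y, f (a⁻¹ * y) * g (y⁻¹ * b) := by
  unfold conv
  rw [← Equiv.sum_comp (Equiv.mulLeft a⁻¹)]
  simp [mul_assoc]

lemma conv_nonneg {f g : G → ℝ} (hf : ∀ x, 0 ≤ f x) (hg : ∀ x, 0 ≤ g x) (x : G) :
    0 ≤ conv f g x :=
  sum_nonneg fun y _ => mul_nonneg (hf y) (hg _)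

lemma sum_conv (f g : G → ℝ) : ∑ x, conv f g x = (∑ x, f x) * ∑ x, g x := by
  unfold conv
  rw [sum_comm, sum_mul]
  refine sum_congr rfl fun y _ => ?_
  rw [← mul_sum]
  congr 1
  exact Equiv.sum_comp (Equiv.mulLeft y⁻¹) g

lemma conv_inv_self_inv (f : G → ℝ) (x : G) :
    conv (fun y => f y⁻¹) f x⁻¹ = conv (fun y => f y⁻¹) f x := by
  unfold conv
  rw [← Equiv.sum_comp (Equiv.mulLeft x⁻¹)]
  refine sum_congr rfl fun y _ => ?_
  simp [mul_comm]

lemma conv_inv_self_one (f : G → ℝ) : conv (fun y => f y⁻¹) f 1 = ∑ x, f x ^ 2 := by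
  unfold conv
  rw [← Equiv.sum_comp (Equiv.inv G)]
  simp [sq]

lemma conv_inv_self_le (f : G → ℝ) (x : G) :
    conv (fun y => f y⁻¹) f x ≤ conv (fun y => f y⁻¹) f 1 := by
  rw [conv_inv_self_one]
  have h1 : ∑ y, f y⁻¹ ^ 2 = ∑ y, f y ^ 2 := Equiv.sum_comp (Equiv.inv G) fun y => f y ^ 2
  have h2 : ∑ y, f (y⁻¹ * x) ^ 2 = ∑ y, f y ^ 2 := by
    rw [← Equiv.sum_comp (Equiv.inv G), ← Equiv.sum_comp (Equiv.mulRight x) (fun y => f y ^ 2)]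
    simp
  have h3 : conv (fun y => f y⁻¹) f x ≤ ∑ y, (f y⁻¹ ^ 2 + f (y⁻¹ * x) ^ 2) / 2 :=
    sum_le_sum fun y _ => by nlinarith [sq_nonneg (f y⁻¹ - f (y⁻¹ * x))]
  rw [← sum_div, sum_add_distrib, h1, h2] at h3
  linarith

lemma conv_self_inv {f : G → ℝ} (hf : ∀ x, f x⁻¹ = f x) (x : G) :
    conv f f x⁻¹ = conv f f x := by
  simpa only [hf] using conv_inv_self_inv f x

lemma conv_self_one {f : G → ℝ} (hf : ∀ x, f x⁻¹ = f x) :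
    conv f f 1 = ∑ x, f x ^ 2 := by
  simpa only [hf] using conv_inv_self_one f

lemma conv_self_le {f : G → ℝ} (hf : ∀ x, f x⁻¹ = f x) (x : G) :
    conv f f x ≤ conv f f 1 := by
  simpa only [hf] using conv_inv_self_le f x

lemma conv_sum_coset_le {f g : G → ℝ} (hf : ∀ x, 0 ≤ f x) (hf1 : ∑ x, f x = 1)
    {H : Subgroup G} {c : ℝ} (hg : ∀ a, ∑ x with a⁻¹ * x ∈ H, g x ≤ c) (a : G) :
    ∑ x with a⁻¹ * x ∈ H, conv f g x ≤ c := by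
  unfold conv
  rw [sum_comm]
  have h : ∀ y, ∑ x with a⁻¹ * x ∈ H, f y * g (y⁻¹ * x) ≤ f y * c := by
    intro y
    rw [← mul_sum]
    refine mul_le_mul_of_nonneg_left ?_ (hf y)
    refine le_trans (le_of_eq ?_) (hg (y⁻¹ * a))
    rw [sum_filter, sum_filter, ← Equiv.sum_comp (Equiv.mulLeft y⁻¹) (fun x => ite _ (g x) 0)]
    simp [mul_assoc]
  calc _ ≤ ∑ y, f y * c := sum_le_sum fun y _ => h y
    _ = c := by rw [← sum_mul, hf1, one_mul]

end Convolution

section SmallQuotient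

open scoped Pointwise

variable {G : Type*} [Group G] [Fintype G] [DecidableEq G]

/-- A form of the Balog–Szemerédi–Gowers theorem: a symmetric probability measure whose
double self-convolution has not become much flatter puts a large mass on a set of small
quotient set. -/
lemma exists_card_inv_mul_le {f : G → ℝ} (hf0 : ∀ x, 0 ≤ f x) (hf1 : ∑ x, f x = 1)
    (hsymm : ∀ x, f x⁻¹ = f x) {M K : ℝ} (hM : ∀ x, f x ≤ M) (hK : 1 ≤ K)
    (hE : M / K ≤ ∑ x, conv f f x ^ 2) :
    ∃ A : Finset G, 1 / (4 * K) ≤ ∑ a ∈ A, f a ∧ (#(A⁻¹ * A) : ℝ) ≤ 4096 * K ^ 3 / M := by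
  have hM0 : 0 < M := by
    by_contra h
    have : ∑ x, f x ≤ 0 := sum_nonpos fun x _ => (hM x).trans (not_lt.1 h)
    linarith
  have hK0 : 0 < K := by linarith
  set g := conv f f with hg
  have hg0 : ∀ x, 0 ≤ g x := conv_nonneg hf0 hf0
  have hg1 : ∑ x, g x = 1 := by rw [hg, sum_conv, hf1, one_mul]
  have hgs : ∀ x, g x⁻¹ = g x := conv_self_inv hsymm
  set w : G → G → ℝ := fun y a => f (y⁻¹ * a) * f a with hw
  have hw0 : ∀ y a, 0 ≤ w y a := fun y a => mul_nonneg (hf0 _) (hf0 _)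
  have hwsum : ∀ y, ∑ a, w y a = g y := by
    intro y
    refine sum_congr rfl fun a _ => ?_
    simp only [hw]
    rw [mul_comm, ← hsymm (y⁻¹ * a)]
    simp
  set θ : ℝ := M / (32 * K) with hθ
  have hθ0 : 0 < θ := by positivity
  set B : G → ℝ := fun y => ∑ a, ∑ b, if g (a⁻¹ * b) < θ then w y a * w y b else 0 with hB
  have hB0 : ∀ y, 0 ≤ B y := fun y => sum_nonneg fun a _ => sum_nonneg fun b _ => by
    split_ifs
    · exact mul_nonneg (hw0 _ _) (hw0 _ _)
    · exact le_rfl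
  have hBsum : ∑ y, B y ≤ θ := by
    rw [hB, sum_comm]
    have : ∀ a, ∑ y, ∑ b, (if g (a⁻¹ * b) < θ then w y a * w y b else 0)
        ≤ ∑ b, f a * f b * θ := by
      intro a
      rw [sum_comm]
      refine sum_le_sum fun b _ => ?_
      split_ifs with h
      · have : ∑ y, w y a * w y b = f a * f b * g (a⁻¹ * b) := by
          rw [hg, conv_inv_mul, mul_sum]
          refine sum_congr rfl fun y _ => ?_
          rw [← hsymm (a⁻¹ * y)]
          simp only [hw, mul_inv_rev, inv_inv]
          ring
        rw [this]
        exact mul_le_mul_of_nonneg_left h.le (mul_nonneg (hf0 _) (hf0 _))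
      · rw [sum_const_zero]
        exact mul_nonneg (mul_nonneg (hf0 _) (hf0 _)) hθ0.le
    refine (sum_le_sum fun a _ => this a).trans (le_of_eq ?_)
    simp_rw [← sum_mul, ← mul_sum, hf1, mul_one, hf1, one_mul]
  obtain ⟨y, hy1, hy2⟩ : ∃ y, M / (2 * K) ≤ g y ∧ B y ≤ g y ^ 2 / 8 := by
    by_contra! hcon
    have h1 : ∀ y, g y ^ 2 ≤ 8 * B y + M / (2 * K) * g y := by
      intro y
      rcases le_or_gt (M / (2 * K)) (g y) with h | h
      · have := hcon y h
        have := mul_nonneg (by positivity : 0 ≤ M / (2 * K)) (hg0 y)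
        linarith
      · nlinarith [hg0 y, hB0 y]
    have h2 := sum_le_sum fun y (_ : y ∈ (univ : Finset G)) => h1 y
    rw [sum_add_distrib, ← mul_sum, ← mul_sum, hg1] at h2
    have h3 : M / K ≤ 8 * θ + M / (2 * K) := by linarith
    have h4 : 8 * θ + M / (2 * K) = 3 / 4 * (M / K) := by rw [hθ]; field_simp; norm_num
    have : 0 < M / K := by positivity
    linarith
  have hgy : 0 < g y := lt_of_lt_of_le (by positivity) hy1
  set bw : G → ℝ := fun a => ∑ b, if g (a⁻¹ * b) < θ then w y b else 0 with hbw
  have hBy : B y = ∑ a, w y a * bw a := by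
    refine sum_congr rfl fun a _ => ?_
    rw [hbw, mul_sum]
    exact sum_congr rfl fun b _ => by split_ifs <;> simp
  have hbw0 : ∀ a, 0 ≤ bw a := fun a => sum_nonneg fun b _ => by
    split_ifs
    · exact hw0 _ _
    · exact le_rfl
  refine ⟨univ.filter fun a => bw a ≤ g y / 4, ?_, ?_⟩
  · set A := univ.filter fun a => bw a ≤ g y / 4
    have h1 : ∑ a with ¬ bw a ≤ g y / 4, w y a ≤ g y / 2 := by
      have : (∑ a with ¬ bw a ≤ g y / 4, w y a) * (g y / 4) ≤ g y ^ 2 / 8 := by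
        rw [sum_mul]
        refine le_trans ?_ (hBy ▸ hy2)
        refine le_trans (sum_le_sum fun a ha => ?_)
          (sum_le_sum_of_subset_of_nonneg (filter_subset _ _)
            fun a _ _ => mul_nonneg (hw0 y a) (hbw0 a))
        exact mul_le_mul_of_nonneg_left (not_le.1 (mem_filter.1 ha).2).le (hw0 _ _)
      nlinarith
    have h2 := sum_filter_add_sum_filter_not univ (fun a => bw a ≤ g y / 4) (w y)
    rw [hwsum] at h2
    have h3 : ∑ a ∈ A, w y a ≤ M * ∑ a ∈ A, f a := by
      rw [mul_sum]
      exact sum_le_sum fun a _ => mul_le_mul_of_nonneg_right (hM _) (hf0 _)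
    have h4 : M / (4 * K) ≤ M * ∑ a ∈ A, f a := by
      have : M / (4 * K) = M / (2 * K) / 2 := by field_simp; norm_num
      linarith
    rw [div_eq_mul_one_div] at h4
    exact le_of_mul_le_mul_left h4 hM0
  · set A := univ.filter fun a => bw a ≤ g y / 4 with hA
    have key : ∀ x ∈ A⁻¹ * A, M / (4096 * K ^ 3) ≤ conv g g x := by
      intro x hx
      obtain ⟨a', ha', c, hc, rfl⟩ := mem_mul.1 hx
      obtain ⟨a, ha, rfl⟩ := mem_inv.1 ha'
      have ha := (mem_filter.1 ha).2
      have hc := (mem_filter.1 hc).2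
      set good := univ.filter fun b => θ ≤ g (a⁻¹ * b) ∧ θ ≤ g (c⁻¹ * b) with hgood
      have h1 : g y / 2 ≤ ∑ b ∈ good, w y b := by
        have : g y ≤ bw a + bw c + ∑ b ∈ good, w y b := by
          rw [← hwsum y, hbw, hgood, sum_filter, ← sum_add_distrib, ← sum_add_distrib]
          refine sum_le_sum fun b _ => ?_
          have := hw0 y b
          split_ifs with p q r r q r r <;>
            first | linarith | exact absurd ⟨not_lt.1 p, not_lt.1 q⟩ r
        linarith
      have h2 : ∑ b ∈ good, w y b ≤ #good * (M * M) := by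
        rw [← nsmul_eq_mul]
        exact sum_le_card_nsmul _ _ _ fun b _ => mul_le_mul (hM _) (hM _) (hf0 _) hM0.le
      have h3 : #good * (θ * θ) ≤ conv g g (a⁻¹ * c) := by
        rw [conv_inv_mul, ← nsmul_eq_mul]
        refine le_trans (card_nsmul_le_sum good (fun b => g (a⁻¹ * b) * g (b⁻¹ * c)) _
          fun b hb => ?_) (sum_le_sum_of_subset_of_nonneg (subset_univ _)
            fun b _ _ => mul_nonneg (hg0 _) (hg0 _))
        have hb := (mem_filter.1 hb).2
        refine mul_le_mul hb.1 ?_ hθ0.le (hg0 _)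
        rw [← hgs]
        simpa using hb.2
      refine le_trans ?_ h3
      have h4 : 1 / (4 * K * M) ≤ #good := by
        have : M / (2 * K) / 2 ≤ #good * (M * M) := by linarith
        rw [div_le_iff₀ (by positivity)]
        rw [div_div, div_le_iff₀ (by positivity)] at this
        nlinarith
      calc M / (4096 * K ^ 3) = 1 / (4 * K * M) * (θ * θ) := by rw [hθ]; field_simp; norm_num
        _ ≤ _ := mul_le_mul_of_nonneg_right h4 (by positivity)
    have h5 : #(A⁻¹ * A) * (M / (4096 * K ^ 3)) ≤ 1 := by
      have : ∑ x, conv g g x = 1 := by rw [sum_conv, hg1, one_mul]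
      rw [← this, ← nsmul_eq_mul]
      exact le_trans (card_nsmul_le_sum _ _ _ key)
        (sum_le_sum_of_subset_of_nonneg (subset_univ _) fun b _ _ => conv_nonneg hg0 hg0 b)
    rw [le_div_iff₀ hM0]
    rw [← mul_div_assoc, div_le_one (by positivity)] at h5
    exact h5

end SmallQuotient

end L2Flattening

namespace L2Flattening

section Growth

open scoped Pointwise Combinatorics.Additive

variable {G : Type*} [Group G] [DecidableEq G]

lemma mulEnergy_inv_right_eq (A : Finset G) : Eₘ[A, A⁻¹] = Eₘ[A⁻¹, A] := by
  unfold mulEnergy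
  refine card_nbij' (fun x => ((x.1.2⁻¹, x.2.2), (x.1.1, x.2.1⁻¹)))
    (fun x => ((x.2.1, x.1.1⁻¹), (x.2.2⁻¹, x.1.2))) ?_ ?_ ?_ ?_
  · rintro ⟨⟨a, b⟩, c, d⟩ h
    simp only [coe_filter, mem_product, Set.mem_ofPred_eq, mem_inv'] at h ⊢
    refine ⟨⟨⟨by simpa using h.1.1.2, h.1.2.2⟩, h.1.1.1, h.1.2.1⟩, ?_⟩
    rw [inv_mul_eq_iff_eq_mul, ← mul_assoc, ← h.2]
    group
  · rintro ⟨⟨a, b⟩, c, d⟩ h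
    simp only [coe_filter, mem_product, Set.mem_ofPred_eq, mem_inv'] at h ⊢
    refine ⟨⟨⟨h.1.2.1, h.1.1.1⟩, by simpa using h.1.2.2, h.1.1.2⟩, ?_⟩
    have h2 := h.2
    rw [mul_inv_eq_iff_eq_mul, mul_assoc, ← h2]
    group
  · rintro ⟨⟨a, b⟩, c, d⟩ h
    simp
  · rintro ⟨⟨a, b⟩, c, d⟩ h
    simp

/-- A set of small quotient set `A⁻¹A` has many quotients `ab⁻¹` with many representations. -/
lemma exists_symmetric_popular [Fintype G] {A : Finset G} (hA : A.Nonempty) {L : ℝ} (hL1 : 1 ≤ L)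
    (hL : (#(A⁻¹ * A) : ℝ) ≤ L * #A) :
    ∃ H : Finset G, 1 ∈ H ∧ H⁻¹ = H ∧ #A / (2 * L) ≤ #H ∧
      ∀ h ∈ H, (#A : ℝ) / (2 * L) ≤ #((A ×ˢ A⁻¹).filter fun p => p.1 * p.2 = h) := by
  have hA0 : (0 : ℝ) < #A := by exact_mod_cast hA.card_pos
  set r : G → Finset (G × G) := fun h => (A ×ˢ A⁻¹).filter fun p => p.1 * p.2 = h with hr
  have hrle : ∀ h, (#(r h) : ℝ) ≤ #A := by
    intro h
    have : #(r h) ≤ #A := by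
      refine card_le_card_of_injOn Prod.fst (fun p hp => ?_) ?_
      · exact (mem_product.1 (mem_filter.1 hp).1).1
      · rintro ⟨a, b⟩ hp ⟨a', b'⟩ hp' (rfl : a = a')
        have h1 := (mem_filter.1 hp).2
        have h2 := (mem_filter.1 hp').2
        simp only at h1 h2
        rw [← h2] at h1
        rw [mul_left_cancel h1]
    exact_mod_cast this
  set H : Finset G := univ.filter fun h => (#A : ℝ) / (2 * L) ≤ #(r h) with hH
  have hone : 1 ∈ H := by
    have : #A ≤ #(r 1) := by
      refine card_le_card_of_injOn (fun a => (a, a⁻¹)) (fun a ha => ?_) ?_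
      · simp only [hr, coe_filter, mem_product, Set.mem_ofPred_eq, mem_inv', inv_inv]
        exact ⟨⟨ha, ha⟩, mul_inv_cancel a⟩
      · intro a _ b _ h
        exact (Prod.mk.inj h).1
    have h' : (#A : ℝ) ≤ #(r 1) := by exact_mod_cast this
    refine mem_filter.2 ⟨mem_univ _, le_trans ?_ h'⟩
    rw [div_le_iff₀ (by positivity)]
    nlinarith
  have hinv : ∀ h ∈ H, h⁻¹ ∈ H := by
    intro h hh
    have : #(r h) ≤ #(r h⁻¹) := by
      refine card_le_card_of_injOn (fun p => (p.2⁻¹, p.1⁻¹)) (fun p hp => ?_) ?_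
      · simp only [hr, coe_filter, mem_product, Set.mem_ofPred_eq, mem_inv', inv_inv] at hp ⊢
        exact ⟨⟨hp.1.2, hp.1.1⟩, by rw [← hp.2, mul_inv_rev]⟩
      · rintro ⟨a, b⟩ _ ⟨a', b'⟩ _ h
        simpa [and_comm] using h
    have h' : (#(r h) : ℝ) ≤ #(r h⁻¹) := by exact_mod_cast this
    exact mem_filter.2 ⟨mem_univ _, (mem_filter.1 hh).2.trans h'⟩
  have hsum : ∑ h, (#(r h) : ℝ) = #A * #A := by
    have : #(A ×ˢ A⁻¹) = ∑ h, #(r h) :=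
      card_eq_sum_card_fiberwise fun _ _ => mem_univ _
    rw [card_product, card_inv] at this
    exact_mod_cast this.symm
  have hHcard : (#A : ℝ) / (2 * L) ≤ #H := by
    have hen : (#A : ℝ) ^ 4 ≤ L * #A * ∑ h, (#(r h) : ℝ) ^ 2 := by
      have h1 := le_card_mul_mul_mulEnergy A⁻¹ A
      rw [← mulEnergy_inv_right_eq, mulEnergy_eq_sum_sq, card_inv] at h1
      have h2 : (#A : ℝ) ^ 2 * #A ^ 2 ≤ #(A⁻¹ * A) * ∑ h, (#(r h) : ℝ) ^ 2 := by
        exact_mod_cast h1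
      calc (#A : ℝ) ^ 4 = #A ^ 2 * #A ^ 2 := by ring
        _ ≤ _ := h2
        _ ≤ _ := mul_le_mul_of_nonneg_right hL (sum_nonneg fun _ _ => sq_nonneg _)
    have hsplit : ∑ h, (#(r h) : ℝ) ^ 2 ≤ #H * #A ^ 2 + #A / (2 * L) * (#A * #A) := by
      rw [← sum_filter_add_sum_filter_not univ (fun h => (#A : ℝ) / (2 * L) ≤ #(r h))]
      refine add_le_add ?_ ?_
      · rw [← nsmul_eq_mul]
        exact sum_le_card_nsmul _ _ _ fun h _ =>
          pow_le_pow_left₀ (Nat.cast_nonneg _) (hrle h) 2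
      · rw [← hsum, mul_sum]
        refine (sum_le_sum fun h hh => ?_).trans
          (sum_le_sum_of_subset_of_nonneg (filter_subset _ _) fun h _ _ =>
            mul_nonneg (by positivity) (Nat.cast_nonneg _))
        rw [sq]
        exact mul_le_mul_of_nonneg_right (not_le.1 (mem_filter.1 hh).2).le (Nat.cast_nonneg _)
    have h3 : (#A : ℝ) ^ 4 ≤ L * #A * (#H * #A ^ 2 + #A / (2 * L) * (#A * #A)) :=
      hen.trans (mul_le_mul_of_nonneg_left hsplit (mul_nonneg (by linarith) hA0.le))
    have h4 : ∀ a h : ℝ, L * a * (h * a ^ 2 + a / (2 * L) * (a * a))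
        = (L * h + a / 2) * a ^ 3 := fun a h => by field_simp
    rw [h4, pow_succ' _ 3] at h3
    have h5 := le_of_mul_le_mul_right h3 (by positivity)
    rw [div_le_iff₀ (by positivity)]
    linarith
  refine ⟨H, hone, ?_, hHcard, fun h hh => (mem_filter.1 hh).2⟩
  ext h
  rw [mem_inv']
  exact ⟨fun hh => by simpa using hinv _ hh, hinv h⟩

/-- Tao's bound for the powers of a set of popular quotients. -/
lemma card_pow_le_of_popular {A H : Finset G} (hA : A.Nonempty) {L : ℝ} (hL1 : 1 ≤ L)
    (hL : (#(A⁻¹ * A) : ℝ) ≤ L * #A)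
    (hH : ∀ h ∈ H, (#A : ℝ) / (2 * L) ≤ #((A ×ˢ A⁻¹).filter fun p => p.1 * p.2 = h)) (m : ℕ) :
    (#(A⁻¹ * H ^ m * A) : ℝ) ≤ (2 * L ^ 2) ^ m * L * #A := by
  have hA0 : (0 : ℝ) < #A := by exact_mod_cast hA.card_pos
  induction m with
  | zero => simpa using hL
  | succ m ih =>
    have hstep : #(A⁻¹ * H ^ (m + 1) * A) * ((#A : ℝ) / (2 * L)) ≤
        #(A⁻¹ * H ^ m * A) * #(A⁻¹ * A) := by
      have h1 : ∀ x ∈ A⁻¹ * H ^ (m + 1) * A, (#A : ℝ) / (2 * L) ≤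
          #(((A⁻¹ * H ^ m * A) ×ˢ (A⁻¹ * A)).filter fun p => p.1 * p.2 = x) := by
        intro x hx
        obtain ⟨y, hy, d, hd, rfl⟩ := mem_mul.1 hx
        obtain ⟨c, hc, z, hz, rfl⟩ := mem_mul.1 hy
        rw [pow_succ] at hz
        obtain ⟨h', hh', h, hh, rfl⟩ := mem_mul.1 hz
        refine (hH h hh).trans ?_
        have : #((A ×ˢ A⁻¹).filter fun p => p.1 * p.2 = h) ≤ #(((A⁻¹ * H ^ m * A) ×ˢ (A⁻¹ * A)).filter
            fun p => p.1 * p.2 = c * (h' * h) * d) := by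
          refine card_le_card_of_injOn (fun p => (c * h' * p.1, p.2 * d)) (fun p hp => ?_) ?_
          · simp only [coe_filter, mem_product, Set.mem_ofPred_eq] at hp ⊢
            refine ⟨⟨mul_mem_mul (mul_mem_mul hc hh') hp.1.1, mul_mem_mul hp.1.2 hd⟩, ?_⟩
            rw [← hp.2]
            group
          · rintro ⟨a, b⟩ _ ⟨a', b'⟩ _ h
            simpa using h
        exact_mod_cast this
      have h2 := card_nsmul_le_sum _ _ _ h1
      rw [nsmul_eq_mul] at h2
      refine h2.trans ?_
      have h3 := (sum_card_fiberwise_eq_card_filter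
        ((A⁻¹ * H ^ m * A) ×ˢ (A⁻¹ * A)) (A⁻¹ * H ^ (m + 1) * A)
        (fun p => p.1 * p.2)).trans_le (card_filter_le _ _)
      rw [card_product] at h3
      exact_mod_cast h3
    have h6 : #(A⁻¹ * H ^ (m + 1) * A) * ((#A : ℝ) / (2 * L)) ≤
        ((2 * L ^ 2) ^ m * L * #A) * (L * #A) :=
      hstep.trans (mul_le_mul ih hL (by positivity) (by positivity))
    rw [← mul_div_assoc, div_le_iff₀ (by positivity)] at h6
    have h7 : (2 * L ^ 2) ^ m * L * #A * (L * #A) * (2 * L)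
      = ((2 * L ^ 2) ^ (m + 1) * L * #A) * (#A : ℝ) := by ring
    rw [h7] at h6
    exact le_of_mul_le_mul_right h6 hA0

/-- If all of the mass `∑ a ∈ A, f a` lies over few translates of `H`, then a coset of any
subgroup containing `H` has large mass. -/
lemma card_mul_sum_le_of_coset [Fintype G] {f : G → ℝ} (hf0 : ∀ x, 0 ≤ f x) {A H : Finset G}
    {Γ : Subgroup G} (hH : ∀ h ∈ H, h ∈ Γ) {c : ℝ}
    (hc : ∀ b, ∑ x with b⁻¹ * x ∈ Γ, f x ≤ c) :
    #H * ∑ a ∈ A, f a ≤ #(A * H) * c := by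
  have h1 : #H * ∑ a ∈ A, f a = ∑ p ∈ A ×ˢ H, f p.1 := by
    rw [sum_product, mul_sum]
    simp
  have h2 : ∑ p ∈ A ×ˢ H, f p.1 = ∑ b ∈ A * H, ∑ p ∈ A ×ˢ H with p.1 * p.2 = b, f p.1 :=
    (sum_fiberwise_of_maps_to (fun p hp => mul_mem_mul (mem_product.1 hp).1
      (mem_product.1 hp).2) _).symm
  rw [h1, h2, ← nsmul_eq_mul]
  refine sum_le_card_nsmul _ _ _ fun b _ => le_trans ?_ (hc b)
  have hinj : Set.InjOn Prod.fst
      (((A ×ˢ H).filter fun p => p.1 * p.2 = b : Finset (G × G)) : Set (G × G)) := by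
    rintro ⟨a, h⟩ hp ⟨a', h'⟩ hp' (rfl : a = a')
    have e1 := (mem_filter.1 hp).2
    have e2 := (mem_filter.1 hp').2
    simp only at e1 e2
    rw [← e2] at e1
    rw [mul_left_cancel e1]
  rw [← sum_image (f := f) hinj]
  refine sum_le_sum_of_subset_of_nonneg (fun x hx => ?_) fun x _ _ => hf0 x
  obtain ⟨⟨a, h⟩, hp, rfl⟩ := mem_image.1 hx
  have hp := mem_filter.1 hp
  refine mem_filter.2 ⟨mem_univ _, ?_⟩
  rw [← hp.2]
  simpa using hH h (mem_product.1 hp.1).2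

end Growth

end L2Flattening

namespace L2Flattening

section MatrixIdentities

variable {F : Type*} [Field F]

/-- The group `SL₂(F)`. -/
abbrev SL₂ (F : Type*) [Field F] := Matrix.SpecialLinearGroup (Fin 2) F

/-- The trace of an element of `SL₂(F)`. -/
def tr (g : SL₂ F) : F := (g : Matrix (Fin 2) (Fin 2) F).trace

/-- The determinant of two vectors in the plane. -/
def cross (v w : Fin 2 → F) : F := v 0 * w 1 - v 1 * w 0

lemma det_eq (g : SL₂ F) : g.1 0 0 * g.1 1 1 - g.1 0 1 * g.1 1 0 = 1 := by
  rw [← Matrix.det_fin_two]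
  exact g.2

lemma tr_eq (g : SL₂ F) : tr g = g.1 0 0 + g.1 1 1 := Matrix.trace_fin_two _

lemma ext_entries {g h : SL₂ F} (h00 : g.1 0 0 = h.1 0 0) (h01 : g.1 0 1 = h.1 0 1)
    (h10 : g.1 1 0 = h.1 1 0) (h11 : g.1 1 1 = h.1 1 1) : g = h := by
  apply Subtype.ext
  ext i j
  fin_cases i <;> fin_cases j <;> assumption

lemma mul_entry (g h : SL₂ F) (i j : Fin 2) :
    (g * h).1 i j = g.1 i 0 * h.1 0 j + g.1 i 1 * h.1 1 j := by
  simp [Matrix.mul_apply, Fin.sum_univ_two]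

lemma inv_entries (g : SL₂ F) : g⁻¹.1 0 0 = g.1 1 1 ∧ g⁻¹.1 0 1 = -g.1 0 1 ∧
    g⁻¹.1 1 0 = -g.1 1 0 ∧ g⁻¹.1 1 1 = g.1 0 0 := by
  simp [Matrix.SpecialLinearGroup.coe_inv, Matrix.adjugate_fin_two]

lemma tr_inv (g : SL₂ F) : tr g⁻¹ = tr g := by
  obtain ⟨h1, -, -, h4⟩ := inv_entries g
  rw [tr_eq, tr_eq, h1, h4, add_comm]

lemma tr_mul_comm (g h : SL₂ F) : tr (g * h) = tr (h * g) := by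
  simp only [tr_eq, mul_entry]
  ring

lemma tr_conj (g h : SL₂ F) : tr (g * h * g⁻¹) = tr h := by
  rw [tr_mul_comm, inv_mul_cancel_left]

lemma tr_mul_add_tr_inv_mul (g h : SL₂ F) : tr (g * h) + tr (g⁻¹ * h) = tr g * tr h := by
  obtain ⟨h1, h2, h3, h4⟩ := inv_entries g
  simp only [tr_eq, mul_entry, h1, h2, h3, h4]
  ring

lemma mulVec_entry (m : Matrix (Fin 2) (Fin 2) F) (v : Fin 2 → F) (i : Fin 2) :
    m.mulVec v i = m i 0 * v 0 + m i 1 * v 1 := by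
  simp [Matrix.mulVec, dotProduct, Fin.sum_univ_two]

lemma smul_of_cross_eq_zero {v w : Fin 2 → F} (hv : v ≠ 0) (h : cross v w = 0) :
    ∃ a : F, w = a • v := by
  unfold cross at h
  by_cases h0 : v 0 = 0
  · have h1 : v 1 ≠ 0 := fun h1 => hv (by ext i; fin_cases i <;> assumption)
    refine ⟨w 1 / v 1, ?_⟩
    ext i
    fin_cases i
    · simp only [Fin.zero_eta, Pi.smul_apply, smul_eq_mul]
      field_simp
      linear_combination -h
    · simp only [Fin.mk_one, Pi.smul_apply, smul_eq_mul]
      field_simp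
  · refine ⟨w 0 / v 0, ?_⟩
    ext i
    fin_cases i
    · simp only [Fin.zero_eta, Pi.smul_apply, smul_eq_mul]
      field_simp
    · simp only [Fin.mk_one, Pi.smul_apply, smul_eq_mul]
      field_simp
      linear_combination h

/-- An eigenvalue is a root of the characteristic polynomial. -/
lemma eigenvalue_root {g : SL₂ F} {v : Fin 2 → F} (hv : v ≠ 0) {a : F}
    (h : g.1.mulVec v = a • v) : a ^ 2 - tr g * a + 1 = 0 := by
  have e0 := congrFun h 0
  have e1 := congrFun h 1
  simp only [mulVec_entry, Pi.smul_apply, smul_eq_mul] at e0 e1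
  have hd := det_eq g
  rw [tr_eq]
  have k0 : (a ^ 2 - (g.1 0 0 + g.1 1 1) * a + 1) * v 0 = 0 := by
    linear_combination (-a + g.1 1 1) * e0 - g.1 0 1 * e1 - v 0 * hd
  have k1 : (a ^ 2 - (g.1 0 0 + g.1 1 1) * a + 1) * v 1 = 0 := by
    linear_combination (-a + g.1 0 0) * e1 - g.1 1 0 * e0 - v 1 * hd
  by_contra hne
  refine hv ?_
  ext i
  fin_cases i
  · exact (mul_eq_zero.1 k0).resolve_left hne
  · exact (mul_eq_zero.1 k1).resolve_left hne

/-- Elements orthogonal to a nilpotent matrix for the trace form fix its kernel. -/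
lemma exists_eigenvector_of_nilpotent {c : Matrix (Fin 2) (Fin 2) F} (hc : c ≠ 0)
    (htr : c 0 0 + c 1 1 = 0) (hdet : c 0 0 * c 1 1 - c 0 1 * c 1 0 = 0) :
    ∃ v : Fin 2 → F, v ≠ 0 ∧ c.mulVec v = 0 ∧ ∀ g : Matrix (Fin 2) (Fin 2) F,
      g 0 0 * c 0 0 + g 0 1 * c 1 0 + g 1 0 * c 0 1 + g 1 1 * c 1 1 = 0 →
        ∃ a : F, g.mulVec v = a • v := by
  have h11 : c 1 1 = -c 0 0 := by linear_combination htr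
  rw [h11] at hdet
  by_cases h1 : c 0 1 = 0
  · have h0 : c 0 0 = 0 := by
      rw [h1] at hdet
      have : c 0 0 * c 0 0 = 0 := by linear_combination -hdet
      simpa using this
    have h2 : c 1 0 ≠ 0 := by
      intro h2
      refine hc ?_
      ext i j
      fin_cases i <;> fin_cases j <;> simp [h0, h1, h2, h11]
    refine ⟨![0, 1], fun h => by simpa using congrFun h 1, ?_, fun g hg => ⟨g 1 1, ?_⟩⟩
    · ext i
      fin_cases i <;> simp [mulVec_entry, h0, h1, h11]
    · have : g 0 1 = 0 := by
        have : g 0 1 * c 1 0 = 0 := by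
          rw [h11, h0, h1] at hg
          linear_combination hg
        exact (mul_eq_zero.1 this).resolve_right h2
      ext i
      fin_cases i <;> simp [mulVec_entry, this]
  · refine ⟨![c 0 1, -c 0 0], fun h => h1 (by simpa using congrFun h 0), ?_, fun g hg => ?_⟩
    · ext i
      fin_cases i
      · simp [mulVec_entry]; ring
      · simp [mulVec_entry, h11]; linear_combination -hdet
    · refine smul_of_cross_eq_zero (fun h => h1 (by simpa using congrFun h 0)) ?_
      rw [h11] at hg
      have : c 0 1 ≠ 0 := h1
      simp only [cross, mulVec_entry, Matrix.cons_val_zero, Matrix.cons_val_one]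
      linear_combination c 0 1 * hg + g 0 1 * hdet

/-- The solutions of `tr m = tr (z m) = tr (w m) = 0` are the multiples of `[z, w]`. -/
lemma exists_smul_commutator {z w m : Matrix (Fin 2) (Fin 2) F} (hc : z * w - w * z ≠ 0)
    (h1 : m.trace = 0) (hz : (z * m).trace = 0) (hw : (w * m).trace = 0) :
    ∃ s : F, m = s • (z * w - w * z) := by
  have hm11 : m 1 1 = -m 0 0 := by
    rw [Matrix.trace_fin_two] at h1
    linear_combination h1
  simp only [Matrix.trace_fin_two, Matrix.mul_apply, Fin.sum_univ_two, hm11] at hz hw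
  set c := z * w - w * z with hcdef
  have c00 : c 0 0 = z 0 1 * w 1 0 - w 0 1 * z 1 0 := by
    simp [hcdef, Matrix.mul_apply, Fin.sum_univ_two]; ring
  have c01 : c 0 1 = (z 0 0 - z 1 1) * w 0 1 - (w 0 0 - w 1 1) * z 0 1 := by
    simp [hcdef, Matrix.mul_apply, Fin.sum_univ_two]; ring
  have c10 : c 1 0 = (w 0 0 - w 1 1) * z 1 0 - (z 0 0 - z 1 1) * w 1 0 := by
    simp [hcdef, Matrix.mul_apply, Fin.sum_univ_two]; ring
  have c11 : c 1 1 = - c 0 0 := by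
    simp [hcdef, Matrix.mul_apply, Fin.sum_univ_two]; ring
  have e1 : m 0 0 * c 0 1 = m 0 1 * c 0 0 := by
    rw [c00, c01]; linear_combination w 0 1 * hz - z 0 1 * hw
  have e2 : m 0 0 * c 1 0 = m 1 0 * c 0 0 := by
    rw [c00, c10]; linear_combination z 1 0 * hw - w 1 0 * hz
  have e3 : m 0 1 * c 1 0 = m 1 0 * c 0 1 := by
    rw [c01, c10]
    linear_combination (w 0 0 - w 1 1) * hz - (z 0 0 - z 1 1) * hw
  have fin : ∀ s : F, m 0 0 = s * c 0 0 → m 0 1 = s * c 0 1 → m 1 0 = s * c 1 0 →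
      m = s • c := by
    intro s k1 k2 k3
    ext i j
    fin_cases i <;> fin_cases j <;> simp [k1, k2, k3, hm11, c11]
  by_cases h00 : c 0 0 = 0
  · by_cases h01 : c 0 1 = 0
    · have h10 : c 1 0 ≠ 0 := by
        intro h10
        refine hc ?_
        ext i j
        fin_cases i <;> fin_cases j <;> simp [h00, h01, h10, c11]
      refine ⟨m 1 0 / c 1 0, fin _ ?_ ?_ ?_⟩ <;> field_simp <;> assumption
    · refine ⟨m 0 1 / c 0 1, fin _ ?_ ?_ ?_⟩ <;> field_simp <;> first | assumption | exact e3.symm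
  · refine ⟨m 0 0 / c 0 0, fin _ ?_ ?_ ?_⟩ <;> field_simp <;> first | exact e1.symm | exact e2.symm

/-- A matrix commuting with a non-scalar matrix `z` lies in `F + F z`. -/
lemma exists_eq_of_commute {z w : SL₂ F} (hz : ¬ (z.1 0 1 = 0 ∧ z.1 1 0 = 0 ∧ z.1 0 0 = z.1 1 1))
    (h : z * w = w * z) : ∃ a b : F, w.1 = a • (1 : Matrix (Fin 2) (Fin 2) F) + b • z.1 := by
  have e00 := congrFun (congrFun (congrArg Subtype.val h) 0) 0
  have e01 := congrFun (congrFun (congrArg Subtype.val h) 0) 1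
  have e10 := congrFun (congrFun (congrArg Subtype.val h) 1) 0
  simp only [mul_entry] at e00 e01 e10
  have fin : ∀ b : F, w.1 0 1 = b * z.1 0 1 → w.1 1 0 = b * z.1 1 0 →
      w.1 0 0 - w.1 1 1 = b * (z.1 0 0 - z.1 1 1) →
      ∃ a b : F, w.1 = a • (1 : Matrix (Fin 2) (Fin 2) F) + b • z.1 := by
    intro b k1 k2 k3
    refine ⟨w.1 0 0 - b * z.1 0 0, b, ?_⟩
    ext i j
    fin_cases i <;> fin_cases j <;> simp [k1, k2]
    linear_combination -k3
  by_cases h01 : z.1 0 1 = 0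
  · by_cases h10 : z.1 1 0 = 0
    · have h3 : z.1 0 0 - z.1 1 1 ≠ 0 := fun h3 => hz ⟨h01, h10, sub_eq_zero.1 h3⟩
      refine fin ((w.1 0 0 - w.1 1 1) / (z.1 0 0 - z.1 1 1)) ?_ ?_ ?_
      · field_simp; linear_combination e01
      · field_simp; linear_combination -e10
      · field_simp
    · refine fin (w.1 1 0 / z.1 1 0) ?_ ?_ ?_
      · field_simp; linear_combination -e00
      · field_simp
      · field_simp; linear_combination e10
  · refine fin (w.1 0 1 / z.1 0 1) ?_ ?_ ?_
    · field_simp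
    · field_simp; linear_combination e00
    · field_simp; linear_combination -e01

end MatrixIdentities

end L2Flattening

namespace L2Flattening

section TracePairs

variable {F : Type*} [Field F]

/-- Nondegeneracy of the intersection of the traces of `x`, `z x`, `w x` at the point `x`. -/
def Transverse (z w x : SL₂ F) : Prop :=
  z.1 * w.1 - w.1 * z.1 ≠ 0 ∧ ¬ ((z.1 * w.1 - w.1 * z.1).det = 0 ∧
    (x⁻¹.1 * (z.1 * w.1 - w.1 * z.1)).trace = 0)

lemma card_le_two_of_transverse {z w : SL₂ F} {t : F} {S : Finset (SL₂ F)}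
    (hS : ∀ x ∈ S, tr x = t ∧ tr (z * x) = t ∧ tr (w * x) = t ∧ Transverse z w x) : #S ≤ 2 := by
  by_contra! h
  obtain ⟨x, hx, y, hy, v, hv, hxy, hxv, hyv⟩ := Finset.two_lt_card.1 h
  obtain ⟨x1, x2, x3, hc, hx4⟩ := hS x hx
  have key : ∀ y ∈ S, ∃ s : F, y.1 = x.1 + s • (z.1 * w.1 - w.1 * z.1) := by
    intro y hy
    obtain ⟨y1, y2, y3, -⟩ := hS y hy
    obtain ⟨s, hs⟩ := exists_smul_commutator (z := z.1) (w := w.1) (m := y.1 - x.1) hc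
      (by rw [Matrix.trace_sub]; exact sub_eq_zero.2 (y1.trans x1.symm))
      (by rw [mul_sub, Matrix.trace_sub]; exact sub_eq_zero.2 (y2.trans x2.symm))
      (by rw [mul_sub, Matrix.trace_sub]; exact sub_eq_zero.2 (y3.trans x3.symm))
    exact ⟨s, by rw [← hs]; abel⟩
  obtain ⟨s, hs⟩ := key y hy
  obtain ⟨r, hr⟩ := key v hv
  set c := z.1 * w.1 - w.1 * z.1 with hcdef
  have det_cond : ∀ (y : SL₂ F) (s : F), y.1 = x.1 + s • c →
      s * ((x⁻¹.1 * c).trace + s * c.det) = 0 := by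
    intro y s hs
    have hd := det_eq y
    have hdx := det_eq x
    obtain ⟨i1, i2, i3, i4⟩ := inv_entries x
    rw [hs] at hd
    simp only [Matrix.add_apply, Matrix.smul_apply, smul_eq_mul] at hd
    rw [Matrix.trace_fin_two, Matrix.det_fin_two]
    simp only [Matrix.mul_apply, Fin.sum_univ_two, i1, i2, i3, i4]
    linear_combination hd - hdx
  have hs0 : s ≠ 0 := by
    rintro rfl
    exact hxy (Subtype.ext (by simpa using hs.symm))
  have hr0 : r ≠ 0 := by
    rintro rfl
    exact hxv (Subtype.ext (by simpa using hr.symm))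
  have hsr : s - r ≠ 0 := by
    intro h
    rw [sub_eq_zero] at h
    subst h
    exact hyv (Subtype.ext (hs.trans hr.symm))
  have e1 := (mul_eq_zero.1 (det_cond y s hs)).resolve_left hs0
  have e2 := (mul_eq_zero.1 (det_cond v r hr)).resolve_left hr0
  have e3 : (s - r) * c.det = 0 := by linear_combination e1 - e2
  have e4 := (mul_eq_zero.1 e3).resolve_left hsr
  exact hx4 ⟨e4, by simpa [e4] using e1⟩

lemma mulVec_inv_of_eigen {g : SL₂ F} {v : Fin 2 → F} {a : F} (ha : a ≠ 0)
    (h : g.1.mulVec v = a • v) : g⁻¹.1.mulVec v = a⁻¹ • v := by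
  have h1 : g⁻¹.1.mulVec (g.1.mulVec v) = v := by
    rw [Matrix.mulVec_mulVec, ← Matrix.SpecialLinearGroup.coe_mul, inv_mul_cancel]
    simp
  rw [h, Matrix.mulVec_smul] at h1
  rw [eq_inv_smul_iff₀ ha, h1]

lemma eigenvalue_ne_zero {g : SL₂ F} {v : Fin 2 → F} (hv : v ≠ 0) {a : F}
    (h : g.1.mulVec v = a • v) : a ≠ 0 := by
  rintro rfl
  simpa using eigenvalue_root hv h

lemma transverse_of_trace (h2 : (2 : F) ≠ 0) {x y v : SL₂ F} {t : F} (ht : t ≠ 0) (hx : tr x = t)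
    (hy : tr y = t) (hv : tr v = t) (hs2 : tr (x⁻¹ * y) ≠ 2) (hst : tr (x⁻¹ * y) ≠ t ^ 2 - 2)
    (hvx : v ≠ x) (hvy : v ≠ y) : Transverse (y * x⁻¹) (v * x⁻¹) x := by
  have hz : tr (y * x⁻¹) = tr (x⁻¹ * y) := tr_mul_comm _ _
  have hzx : y * x⁻¹ * x = y := by group
  have hwx : v * x⁻¹ * x = v := by group
  set s := tr (x⁻¹ * y) with hs
  have hyz : y⁻¹ = x⁻¹ * (y * x⁻¹)⁻¹ := by simp
  generalize y * x⁻¹ = z at *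
  generalize v * x⁻¹ = w at *
  have hc : z.1 * w.1 - w.1 * z.1 ≠ 0 := by
    intro hc
    have hns : ¬ (z.1 0 1 = 0 ∧ z.1 1 0 = 0 ∧ z.1 0 0 = z.1 1 1) := by
      rintro ⟨k1, k2, k3⟩
      have hd := det_eq z
      rw [tr_eq] at hz
      rw [k1, k3] at hd
      rw [k3] at hz
      have : (z.1 1 1 - 1) * (z.1 1 1 + 1) = 0 := by linear_combination hd
      rcases mul_eq_zero.1 this with h | h
      · exact hs2 (by linear_combination -hz + 2 * h)
      · have e : tr y = - tr x := by
          rw [← hzx, tr_eq, tr_eq, mul_entry, mul_entry, k1, k2, k3]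
          linear_combination (x.1 0 0 + x.1 1 1) * h
        rw [hx, hy] at e
        have : 2 * t = 0 := by linear_combination e
        exact (mul_ne_zero h2 ht) this
    obtain ⟨a, b, hab⟩ := exists_eq_of_commute (z := z) (w := w) hns
      (Subtype.ext (by simpa using sub_eq_zero.1 hc))
    have hvm : v.1 = a • x.1 + b • y.1 := by
      have : v.1 = w.1 * x.1 := by rw [← Matrix.SpecialLinearGroup.coe_mul, hwx]
      rw [this, hab, add_mul, Matrix.smul_mul, Matrix.smul_mul, one_mul,
        ← Matrix.SpecialLinearGroup.coe_mul, hzx]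
    have hve : ∀ i j, v.1 i j = a * x.1 i j + b * y.1 i j := fun i j => by rw [hvm]; simp
    have hdx := det_eq x
    have hdy := det_eq y
    have hdv := det_eq v
    obtain ⟨i1, i2, i3, i4⟩ := inv_entries x
    have hse : s = x.1 1 1 * y.1 0 0 - x.1 0 1 * y.1 1 0 - x.1 1 0 * y.1 0 1 +
        x.1 0 0 * y.1 1 1 := by
      rw [hs, tr_eq, mul_entry, mul_entry, i1, i2, i3, i4]; ring
    rw [tr_eq] at hx hy hv
    rw [hve, hve] at hv
    simp only [hve] at hdv
    have hab1 : b = 1 - a := by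
      have : (a + b - 1) * t = 0 := by linear_combination hv - a * hx - b * hy
      linear_combination (mul_eq_zero.1 this).resolve_right ht
    subst hab1
    have : a * (1 - a) * (s - 2) = 0 := by
      rw [hse]
      linear_combination hdv - a ^ 2 * hdx - (1 - a) ^ 2 * hdy
    have := (mul_eq_zero.1 this).resolve_right (sub_ne_zero.2 hs2)
    rcases mul_eq_zero.1 this with h | h
    · exact hvy (Subtype.ext (by rw [hvm, h]; simp))
    · have : a = 1 := by linear_combination -h
      exact hvx (Subtype.ext (by rw [hvm, this]; simp))
  refine ⟨hc, ?_⟩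
  rintro ⟨hdet, htr⟩
  set c := z.1 * w.1 - w.1 * z.1 with hcdef
  have htr0 : c.trace = 0 := by rw [hcdef, Matrix.trace_sub, Matrix.trace_mul_comm, sub_self]
  rw [Matrix.trace_fin_two] at htr0
  rw [Matrix.det_fin_two] at hdet
  obtain ⟨u, hu, -, hfix⟩ := exists_eigenvector_of_nilpotent hc htr0 hdet
  obtain ⟨l, hl⟩ := hfix x⁻¹.1 (by
    simpa [Matrix.trace_fin_two, Matrix.mul_apply, Fin.sum_univ_two, add_assoc] using htr)
  obtain ⟨k, hk⟩ := hfix z.1 (by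
    simp only [hcdef, Matrix.sub_apply, Matrix.mul_apply, Fin.sum_univ_two]; ring)
  have hk0 := eigenvalue_ne_zero hu hk
  have hy' : y⁻¹.1.mulVec u = (k⁻¹ * l) • u := by
    rw [hyz, Matrix.SpecialLinearGroup.coe_mul, ← Matrix.mulVec_mulVec, mulVec_inv_of_eigen hk0 hk, Matrix.mulVec_smul, hl,
      smul_smul]
  have r1 := eigenvalue_root hu hl
  have r2 := eigenvalue_root hu hk
  have r3 := eigenvalue_root hu hy'
  rw [tr_inv] at r1 r3
  rw [hx] at r1
  rw [hy] at r3
  rw [hz] at r2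
  obtain ⟨m, hm⟩ : ∃ m, m = k⁻¹ * l := ⟨_, rfl⟩
  rw [← hm] at r3
  have hlm : l = k * m := by rw [hm]; field_simp
  have : (l - m) * (l + m - t) = 0 := by linear_combination r1 - r3
  rcases mul_eq_zero.1 this with h | h
  · have hm0 : m ≠ 0 := eigenvalue_ne_zero hu (hy'.trans (by rw [hm]))
    have : (k - 1) * m = 0 := by linear_combination h - hlm
    have hk1 : k = 1 := sub_eq_zero.1 ((mul_eq_zero.1 this).resolve_right hm0)
    rw [hk1] at r2
    exact hs2 (by linear_combination -r2)
  · have hl0 : l ≠ 0 := eigenvalue_ne_zero hu hl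
    have ht' : t = l + m := by linear_combination -h
    rw [ht'] at r1
    have hlm1 : l * m = 1 := by linear_combination -r1
    have hkl : k = l ^ 2 := by linear_combination -k * hlm1 - l * hlm
    have : l ^ 2 * (s - (t ^ 2 - 2)) = 0 := by
      rw [hkl] at r2
      rw [ht']
      linear_combination -r2 - (l * m + 1 + 2 * l ^ 2) * hlm1
    exact hst (sub_eq_zero.1 ((mul_eq_zero.1 this).resolve_left (pow_ne_zero 2 hl0)))

lemma exists_common_eigenvector_aux {x y : SL₂ F} {t : F} (hx : tr x = t) (hy : tr y = t)
    (hs : tr (x⁻¹ * y) = 2) (hyx : y ≠ x) :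
    ∃ v : Fin 2 → F, v ≠ 0 ∧ (∃ a : F, x.1.mulVec v = a • v) ∧ ∃ b : F, y.1.mulVec v = b • v := by
  obtain ⟨i1, i2, i3, i4⟩ := inv_entries x
  have hdx := det_eq x
  have hdy := det_eq y
  rw [tr_eq, mul_entry, mul_entry, i1, i2, i3, i4] at hs
  rw [tr_eq] at hx hy
  obtain ⟨v, hv, -, hfix⟩ := exists_eigenvector_of_nilpotent (c := y.1 - x.1)
    (sub_ne_zero.2 fun h => hyx (Subtype.ext h))
    (by simp only [Matrix.sub_apply]; linear_combination hy - hx)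
    (by simp only [Matrix.sub_apply]; linear_combination hdx + hdy - hs)
  refine ⟨v, hv, hfix x.1 ?_, hfix y.1 ?_⟩
  · simp only [Matrix.sub_apply]
    linear_combination (x.1 0 0 + x.1 1 1) * (hy - hx) + 2 * hdx - hs
  · simp only [Matrix.sub_apply]
    linear_combination (y.1 0 0 + y.1 1 1) * (hy - hx) - 2 * hdy + hs

lemma exists_common_eigenvector {x y : SL₂ F} {t : F} (hx : tr x = t) (hy : tr y = t)
    (hs : tr (x⁻¹ * y) = 2 ∨ tr (x⁻¹ * y) = t ^ 2 - 2) (hyx : y ≠ x) (hyx' : y ≠ x⁻¹) :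
    ∃ v : Fin 2 → F, v ≠ 0 ∧ (∃ a : F, x.1.mulVec v = a • v) ∧ ∃ b : F, y.1.mulVec v = b • v := by
  rcases hs with hs | hs
  · exact exists_common_eigenvector_aux hx hy hs hyx
  · have hs' : tr (x⁻¹⁻¹ * y) = 2 := by
      have := tr_mul_add_tr_inv_mul x y
      rw [hx, hy, hs] at this
      rw [inv_inv]
      linear_combination this
    obtain ⟨v, hv, ⟨a, ha⟩, hb⟩ :=
      exists_common_eigenvector_aux ((tr_inv x).trans hx) hy hs' hyx'
    refine ⟨v, hv, ⟨a⁻¹, ?_⟩, hb⟩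
    simpa using mulVec_inv_of_eigen (eigenvalue_ne_zero hv ha) ha

/-- Eigenspaces of a non-scalar element are lines. -/
lemma exists_smul_of_eigen {x : SL₂ F} (hx : tr x ^ 2 ≠ 4) {v w : Fin 2 → F} (hv : v ≠ 0) {a : F}
    (h1 : x.1.mulVec v = a • v) (h2 : x.1.mulVec w = a • w) : ∃ b : F, w = b • v := by
  refine smul_of_cross_eq_zero hv ?_
  by_contra hne
  have e0 := congrFun h1 0
  have e1 := congrFun h1 1
  have f0 := congrFun h2 0
  have f1 := congrFun h2 1
  simp only [mulVec_entry, Pi.smul_apply, smul_eq_mul] at e0 e1 f0 f1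
  have hd := det_eq x
  have k1 : (x.1 0 0 - a) * cross v w = 0 := by
    unfold cross; linear_combination w 1 * e0 - v 1 * f0
  have k2 : (x.1 1 1 - a) * cross v w = 0 := by
    unfold cross; linear_combination v 0 * f1 - w 0 * e1
  have k3 : x.1 0 1 * cross v w = 0 := by
    unfold cross; linear_combination v 0 * f0 - w 0 * e0
  have l1 := (mul_eq_zero.1 k1).resolve_right hne
  have l2 := (mul_eq_zero.1 k2).resolve_right hne
  have l3 := (mul_eq_zero.1 k3).resolve_right hne
  refine hx ?_
  rw [tr_eq, sub_eq_zero.1 l1, sub_eq_zero.1 l2]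
  rw [sub_eq_zero.1 l1, sub_eq_zero.1 l2, l3] at hd
  linear_combination 4 * hd

/-- Elements agreeing on two independent vectors are equal. -/
lemma eq_of_mulVec_eq {x y : SL₂ F} {v w : Fin 2 → F} (hvw : cross v w ≠ 0)
    (h1 : x.1.mulVec v = y.1.mulVec v) (h2 : x.1.mulVec w = y.1.mulVec w) : x = y := by
  have key : ∀ i, x.1 i 0 = y.1 i 0 ∧ x.1 i 1 = y.1 i 1 := by
    intro i
    have e := congrFun h1 i
    have f := congrFun h2 i
    simp only [mulVec_entry] at e f
    have k1 : (x.1 i 0 - y.1 i 0) * cross v w = 0 := by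
      unfold cross; linear_combination w 1 * e - v 1 * f
    have k2 : (x.1 i 1 - y.1 i 1) * cross v w = 0 := by
      unfold cross; linear_combination v 0 * f - w 0 * e
    exact ⟨sub_eq_zero.1 ((mul_eq_zero.1 k1).resolve_right hvw),
      sub_eq_zero.1 ((mul_eq_zero.1 k2).resolve_right hvw)⟩
  exact ext_entries (key 0).1 (key 0).2 (key 1).1 (key 1).2

end TracePairs

end L2Flattening

namespace L2Flattening

section Powers

/-- An increasing family of symmetric finite sets behaving like the powers of a finite set. -/
structure SymmetricPowers (G : Type*) [Group G] where
  /-- The sets of the family. -/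
  sets : ℕ → Finset G
  one_mem : 1 ∈ sets 0
  mul_mem : ∀ {m n k : ℕ} {x y : G}, m + n ≤ k → x ∈ sets m → y ∈ sets n → x * y ∈ sets k
  inv_mem : ∀ {n : ℕ} {x : G}, x ∈ sets n → x⁻¹ ∈ sets n

namespace SymmetricPowers

variable {G : Type*} [Group G]

lemma mono (P : SymmetricPowers G) {m n : ℕ} (h : m ≤ n) : P.sets m ⊆ P.sets n := fun x hx => by
  simpa using P.mul_mem (by simpa using h) hx P.one_mem

lemma pow_mem (P : SymmetricPowers G) {m : ℕ} {x : G} (hx : x ∈ P.sets m) (k : ℕ) :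
    x ^ k ∈ P.sets (m * k) := by
  induction k with
  | zero => simpa using P.one_mem
  | succ k ih =>
    rw [pow_succ]
    exact P.mul_mem le_rfl ih hx

open scoped Pointwise in
/-- The powers of a symmetric set containing `1`. -/
def ofFinset [DecidableEq G] (A : Finset G) (hA : A⁻¹ = A) (h1 : 1 ∈ A) : SymmetricPowers G where
  sets n := A ^ n
  one_mem := by simp
  mul_mem hk hx hy := by
    refine Finset.pow_subset_pow_right h1 hk ?_
    rw [pow_add]
    exact Finset.mul_mem_mul hx hy
  inv_mem hx := by
    rw [← hA, inv_pow]
    exact Finset.inv_mem_inv hx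

end SymmetricPowers

end Powers

section TraceBound

variable {F : Type*} [Field F] {P Q : Finset (SL₂ F)}

lemma sq_card_le_of_eigenvector {Y : Finset (SL₂ F)} (hY : Y ⊆ P)
    {v : Fin 2 → F} (hv : v ≠ 0) {b : F} (hb : ∀ y ∈ Y, y.1.mulVec v = b • v)
    {g : SL₂ F} (hg : ∀ y ∈ P, ∀ z ∈ P, y * g * z ∈ Q)
    (hgv : cross v (g.1.mulVec v) ≠ 0) : #Y ^ 2 ≤ #Q := by
  rw [sq, ← Finset.card_product]
  refine Finset.card_le_card_of_injOn (fun q => q.1 * g * q.2) ?_ ?_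
  · rintro ⟨y, z⟩ hq
    obtain ⟨hy, hz⟩ := Finset.mem_product.1 hq
    exact hg y (hY hy) z (hY hz)
  · rintro ⟨y, z⟩ hq ⟨y', z'⟩ hq' h
    obtain ⟨hy, hz⟩ := Finset.mem_product.1 hq
    obtain ⟨hy', hz'⟩ := Finset.mem_product.1 hq'
    have hb0 : b ≠ 0 := eigenvalue_ne_zero hv (hb y hy)
    have h' : y * g * z = y' * g * z' := h
    have e := congrArg (fun m : SL₂ F => m.1.mulVec v) h'
    simp only [Matrix.SpecialLinearGroup.coe_mul, ← Matrix.mulVec_mulVec, hb z hz, hb z' hz',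
      Matrix.mulVec_smul] at e
    have hyy : y = y' := eq_of_mulVec_eq hgv ((hb y hy).trans (hb y' hy').symm)
      (smul_right_injective _ hb0 e)
    subst hyy
    exact Prod.ext rfl (mul_left_cancel h')

lemma exists_roots_finset (t : F) :
    ∃ R : Finset F, #R ≤ 2 ∧ ∀ a : F, a ^ 2 - t * a + 1 = 0 → a ∈ R := by
  by_cases h : ∃ a : F, a ^ 2 - t * a + 1 = 0
  · obtain ⟨a, ha⟩ := h
    refine ⟨{a, t - a}, Finset.card_le_two, fun b hb => ?_⟩
    have : (b - a) * (b - (t - a)) = 0 := by linear_combination hb - ha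
    rw [Finset.mem_insert, Finset.mem_singleton]
    rcases mul_eq_zero.1 this with h | h
    · exact Or.inl (sub_eq_zero.1 h)
    · exact Or.inr (sub_eq_zero.1 h)
  · exact ⟨∅, by simp, fun a ha => (h ⟨a, ha⟩).elim⟩

lemma card_degenerate_le
    (hgen : ∀ v : Fin 2 → F, v ≠ 0 → ∃ g : SL₂ F, (∀ y ∈ P, ∀ z ∈ P, y * g * z ∈ Q) ∧
      cross v (g.1.mulVec v) ≠ 0) {t : F} (ht : t ^ 2 ≠ 4)
    {x : SL₂ F} (hx : tr x = t) :
    #{y ∈ P | tr y = t ∧ (tr (x⁻¹ * y) = 2 ∨ tr (x⁻¹ * y) = t ^ 2 - 2)} ≤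
      2 + 4 * Nat.sqrt #Q := by
  obtain ⟨R, hR, hroot⟩ := exists_roots_finset t
  set Y : F × F → Finset (SL₂ F) := fun q => {y ∈ P | ∃ v : Fin 2 → F, v ≠ 0 ∧
    x.1.mulVec v = q.1 • v ∧ y.1.mulVec v = q.2 • v} with hYdef
  have hYcard : ∀ q, #(Y q) ≤ Nat.sqrt #Q := by
    intro q
    rw [Nat.le_sqrt']
    rcases (Y q).eq_empty_or_nonempty with he | ⟨y, hy⟩
    · simp [he]
    · obtain ⟨-, v, hv, hxv, -⟩ := Finset.mem_filter.1 hy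
      obtain ⟨g, hg, hgv⟩ := hgen v hv
      refine sq_card_le_of_eigenvector (Finset.filter_subset _ _) hv (b := q.2) ?_ hg hgv
      intro z hz
      obtain ⟨-, w, hw, hxw, hzw⟩ := Finset.mem_filter.1 hz
      obtain ⟨c, hc⟩ := exists_smul_of_eigen (by rwa [hx]) hw hxw hxv
      rw [hc, Matrix.mulVec_smul, hzw, smul_comm]
  have hsub : ({y ∈ P | tr y = t ∧ (tr (x⁻¹ * y) = 2 ∨ tr (x⁻¹ * y) = t ^ 2 - 2)} :
      Finset (SL₂ F)) ⊆ {x, x⁻¹} ∪ (R ×ˢ R).biUnion Y := by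
    intro y hy
    obtain ⟨hyA, hyt, hs⟩ := Finset.mem_filter.1 hy
    by_cases hyx : y = x
    · simp [hyx]
    by_cases hyx' : y = x⁻¹
    · simp [hyx']
    obtain ⟨v, hv, ⟨a, ha⟩, b, hb⟩ := exists_common_eigenvector hx hyt hs hyx hyx'
    refine Finset.mem_union_right _ (Finset.mem_biUnion.2 ⟨(a, b), ?_, ?_⟩)
    · refine Finset.mem_product.2 ⟨hroot _ ?_, hroot _ ?_⟩
      · rw [← hx]; exact eigenvalue_root hv ha
      · rw [← hyt]; exact eigenvalue_root hv hb
    · exact Finset.mem_filter.2 ⟨hyA, v, hv, ha, hb⟩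
  refine (Finset.card_le_card hsub).trans ((Finset.card_union_le _ _).trans ?_)
  refine add_le_add Finset.card_le_two ?_
  refine (Finset.card_biUnion_le_card_mul _ _ _ fun q _ => hYcard q).trans ?_
  refine Nat.mul_le_mul_right _ ?_
  rw [Finset.card_product]
  exact Nat.mul_le_mul hR hR

/-- Few elements of `P` share the same trace. -/
lemma card_trace_fibre_le (h2 : (2 : F) ≠ 0) (hPQ : ∀ x ∈ P, ∀ y ∈ P, y * x⁻¹ ∈ Q)
    (hgen : ∀ v : Fin 2 → F, v ≠ 0 → ∃ g : SL₂ F, (∀ y ∈ P, ∀ z ∈ P, y * g * z ∈ Q) ∧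
      cross v (g.1.mulVec v) ≠ 0) {t : F} (ht0 : t ≠ 0) (ht : t ^ 2 ≠ 4) :
    #{x ∈ P | tr x = t} ^ 3 ≤ 1728 * #Q ^ 2 := by
  set X : Finset (SL₂ F) := {x ∈ P | tr x = t} with hX
  set B : SL₂ F → Finset (SL₂ F) := fun x =>
    {y ∈ X | tr (x⁻¹ * y) ≠ 2 ∧ tr (x⁻¹ * y) ≠ t ^ 2 - 2} with hB
  set γ := Nat.sqrt #Q with hγ
  have hXmem : ∀ x ∈ X, x ∈ P ∧ tr x = t := fun x hx => Finset.mem_filter.1 hx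
  have hBcard : ∀ x ∈ X, #X - (2 + 4 * γ) ≤ #(B x) := by
    intro x hx
    have h := card_degenerate_le hgen ht (hXmem x hx).2
    have hsplit := Finset.card_filter_add_card_filter_not (s := X)
      (fun y => tr (x⁻¹ * y) ≠ 2 ∧ tr (x⁻¹ * y) ≠ t ^ 2 - 2)
    have : #{y ∈ X | ¬ (tr (x⁻¹ * y) ≠ 2 ∧ tr (x⁻¹ * y) ≠ t ^ 2 - 2)} ≤ 2 + 4 * γ := by
      refine le_trans (Finset.card_le_card ?_) h
      intro y hy
      obtain ⟨hyX, hy⟩ := Finset.mem_filter.1 hy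
      obtain ⟨hyA, hyt⟩ := hXmem y hyX
      refine Finset.mem_filter.2 ⟨hyA, hyt, ?_⟩
      tauto
    simp only [hB]
    omega
  set T := X.sigma fun x => (B x).sigma fun y => X \ {x, y} with hT
  have hTlow : #X * ((#X - (2 + 4 * γ)) * (#X - 2)) ≤ #T := by
    rw [hT, Finset.card_sigma, ← smul_eq_mul]
    refine Finset.card_nsmul_le_sum _ _ _ fun x hx => ?_
    rw [Finset.card_sigma]
    refine (Nat.mul_le_mul_right _ (hBcard x hx)).trans ?_
    rw [← smul_eq_mul]
    refine Finset.card_nsmul_le_sum _ _ _ fun y hy => ?_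
    exact (Nat.sub_le_sub_left Finset.card_le_two _).trans (Finset.le_card_sdiff _ _)
  have hTup : #T ≤ 2 * #Q ^ 2 := by
    have hmap : ∀ q ∈ T, (q.2.1 * q.1⁻¹, q.2.2 * q.1⁻¹) ∈ Q ×ˢ Q := by
      rintro ⟨x, y, v⟩ hq
      simp only [hT, Finset.mem_sigma, Finset.mem_sdiff] at hq
      have hx := (hXmem x hq.1).1
      have hy := (hXmem y (Finset.mem_filter.1 hq.2.1).1).1
      have hv := (hXmem v hq.2.2.1).1
      exact Finset.mem_product.2 ⟨hPQ x hx y hy,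
        hPQ x hx v hv⟩
    refine (Finset.card_le_mul_card_image_of_maps_to hmap 2 ?_).trans ?_
    · rintro ⟨z, w⟩ -
      set S := T.filter fun q => (q.2.1 * q.1⁻¹, q.2.2 * q.1⁻¹) = (z, w) with hS
      have hSmem : ∀ q ∈ S, q ∈ T ∧ q.2.1 = z * q.1 ∧ q.2.2 = w * q.1 := by
        intro q hq
        obtain ⟨hqT, hq⟩ := Finset.mem_filter.1 hq
        rw [Prod.mk.injEq] at hq
        exact ⟨hqT, by rw [← hq.1]; group, by rw [← hq.2]; group⟩
      have hinj : Set.InjOn (fun q : (_ : SL₂ F) × (_ : SL₂ F) × SL₂ F => q.1) S := by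
        rintro ⟨x, y, v⟩ hq ⟨x', y', v'⟩ hq' h
        obtain ⟨-, e1, e2⟩ := hSmem _ hq
        obtain ⟨-, e3, e4⟩ := hSmem _ hq'
        simp only at h e1 e2 e3 e4
        subst h
        rw [e1, e2, e3, e4]
      rw [← Finset.card_image_of_injOn hinj]
      refine card_le_two_of_transverse (z := z) (w := w) (t := t) ?_
      intro x hx
      obtain ⟨⟨x', y, v⟩, hq, rfl⟩ := Finset.mem_image.1 hx
      obtain ⟨hqT, e1, e2⟩ := hSmem _ hq
      simp only [hT, Finset.mem_sigma, Finset.mem_sdiff, Finset.mem_insert,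
        Finset.mem_singleton, not_or] at hqT
      obtain ⟨hxX, hyB, hvX, hvx, hvy⟩ := hqT
      obtain ⟨hyX, hs⟩ := Finset.mem_filter.1 hyB
      simp only at e1 e2 ⊢
      refine ⟨(hXmem _ hxX).2, e1 ▸ (hXmem _ hyX).2, e2 ▸ (hXmem _ hvX).2, ?_⟩
      have := transverse_of_trace h2 ht0 (hXmem _ hxX).2 (hXmem _ hyX).2 (hXmem _ hvX).2
        hs.1 hs.2 hvx hvy
      rwa [e1, e2, mul_inv_cancel_right, mul_inv_cancel_right] at this
    · rw [Finset.card_product, sq]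
  rcases X.eq_empty_or_nonempty with he | ⟨x, hx⟩
  · simp [he]
  have hQ1 : 1 ≤ #Q := Finset.card_pos.2 ⟨_, hPQ x (hXmem x hx).1 x (hXmem x hx).1⟩
  have hγ1 : 1 ≤ γ := by rw [hγ, Nat.le_sqrt']; simpa using hQ1
  have hγQ : γ ^ 2 ≤ #Q := Nat.sqrt_le' _
  by_cases hN : 8 * γ + 4 ≤ #X
  · obtain ⟨d, hd⟩ := Nat.exists_eq_add_of_le hN
    have e1 : #X - (2 + 4 * γ) = 4 * γ + 2 + d := by omega
    have e2 : #X - 2 = 8 * γ + 2 + d := by omega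
    rw [e1, e2] at hTlow
    have h3 := hTlow.trans hTup
    have h4 : #X ^ 3 ≤ 4 * (#X * ((4 * γ + 2 + d) * (8 * γ + 2 + d))) := by
      have a1 : #X ≤ 2 * (4 * γ + 2 + d) := by omega
      have a2 : #X ≤ 2 * (8 * γ + 2 + d) := by omega
      calc #X ^ 3 = #X * (#X * #X) := by ring
        _ ≤ #X * ((2 * (4 * γ + 2 + d)) * (2 * (8 * γ + 2 + d))) :=
          Nat.mul_le_mul_left _ (Nat.mul_le_mul a1 a2)
        _ = _ := by ring
    nlinarith
  · have a1 : #X ≤ 12 * γ := by omega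
    calc #X ^ 3 ≤ (12 * γ) ^ 3 := Nat.pow_le_pow_left a1 3
      _ = 1728 * (γ ^ 2 * γ) := by ring
      _ ≤ 1728 * (#Q * #Q) := by
        refine Nat.mul_le_mul_left _ (Nat.mul_le_mul hγQ (le_trans ?_ hγQ))
        nlinarith
      _ = 1728 * #Q ^ 2 := by ring

end TraceBound

end L2Flattening

namespace L2Flattening

section Escape

variable {F : Type*} [Field F]

/-- The central element `-1` of `SL₂(F)`. -/
def negOne : SL₂ F := ⟨-1, by simp [Matrix.det_fin_two]⟩

lemma coe_negOne : (negOne : SL₂ F).1 = -1 := rfl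

lemma negOne_mul_entry (x : SL₂ F) (i j : Fin 2) : (negOne * x).1 i j = -x.1 i j := by
  rw [Matrix.SpecialLinearGroup.coe_mul, coe_negOne]
  simp

lemma eq_one_or_negOne {z : SL₂ F} (hz : z.1 0 1 = 0 ∧ z.1 1 0 = 0 ∧ z.1 0 0 = z.1 1 1) :
    z = 1 ∨ z = negOne := by
  obtain ⟨k1, k2, k3⟩ := hz
  have hd := det_eq z
  rw [k1, k3] at hd
  have : (z.1 1 1 - 1) * (z.1 1 1 + 1) = 0 := by linear_combination hd
  rcases mul_eq_zero.1 this with h | h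
  · left
    have h' := sub_eq_zero.1 h
    exact ext_entries (by simp [k3, h']) (by simp [k1]) (by simp [k2]) (by simp [h'])
  · right
    have h' := eq_neg_of_add_eq_zero_left h
    exact ext_entries (by simp [k3, h', negOne]) (by simp [k1, negOne]) (by simp [k2, negOne])
      (by simp [h', negOne])

lemma inv_eq_of_tr_eq_zero {x : SL₂ F} (hx : tr x = 0) : x⁻¹ = negOne * x := by
  obtain ⟨i1, i2, i3, i4⟩ := inv_entries x
  rw [tr_eq] at hx
  refine ext_entries ?_ ?_ ?_ ?_ <;> simp only [negOne_mul_entry, i1, i2, i3, i4]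
  · linear_combination hx
  · linear_combination hx

/-- There is no family of three anticommuting traceless elements whose product is traceless. -/
lemma not_all_traceless (h2 : (2 : F) ≠ 0) {x y z : SL₂ F} (hx : tr x = 0) (hy : tr y = 0)
    (hz : tr z = 0) (hxy : tr (x * y) = 0) (hxz : tr (x * z) = 0) (hyz : tr (y * z) = 0) :
    tr (x * y * z) ≠ 0 := by
  intro hxyz
  have hx1 : x.1 1 1 = -x.1 0 0 := by rw [tr_eq] at hx; linear_combination hx
  have hy1 : y.1 1 1 = -y.1 0 0 := by rw [tr_eq] at hy; linear_combination hy
  have hp := hxy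
  rw [tr_eq] at hp
  have hc : x.1 * y.1 - y.1 * x.1 = (2 : F) • (x * y).1 := by
    simp only [mul_entry] at hp
    ext i j
    fin_cases i <;> fin_cases j <;>
      simp [Matrix.mul_apply, Fin.sum_univ_two, hx1, hy1] <;>
      rw [hx1, hy1] at hp
    · linear_combination -hp
    · ring
    · ring
    · linear_combination -hp
  have hne : x.1 * y.1 - y.1 * x.1 ≠ 0 := by
    rw [hc]
    intro h
    have hd := det_eq (x * y)
    have e := (smul_eq_zero.1 h).resolve_left h2
    rw [e] at hd
    simp at hd
  obtain ⟨s, hs⟩ := exists_smul_commutator hne (m := z.1) hz hxz hyz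
  rw [hc] at hs
  have hze : ∀ i j, z.1 i j = s * (2 * (x * y).1 i j) := fun i j => by rw [hs]; simp
  have hdz := det_eq z
  have hd := det_eq (x * y)
  have h11 : (x * y).1 1 1 = -(x * y).1 0 0 := by linear_combination hp
  rw [tr_eq, mul_entry (x * y), mul_entry (x * y)] at hxyz
  simp only [hze, h11] at hxyz hdz hd
  have h4 : s * (2 * 2) = 0 := by linear_combination -hxyz - 4 * s * hd
  have hs0 : s = 0 := (mul_eq_zero.1 h4).resolve_right (mul_ne_zero h2 h2)
  rw [hs0] at hdz
  simp at hdz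

/-- Translating `y` by powers of a parabolic element produces an element of nonexceptional
trace. -/
lemma exists_good_trace_of_parabolic (h2 : (2 : F) ≠ 0) (h3 : (3 : F) ≠ 0) {u y : SL₂ F} {e : F}
    (he : e = 1 ∨ e = -1) (hu : tr u = 2 * e) (hy : tr (u * y) ≠ e * tr y) :
    ∃ k ≤ 3, tr (u ^ k * y) ≠ 0 ∧ tr (u ^ k * y) ^ 2 ≠ 4 := by
  by_contra! h
  have hP : ∀ k ≤ 3, tr (u ^ k * y) ^ 3 = 4 * tr (u ^ k * y) := by
    intro k hk
    by_cases h0 : tr (u ^ k * y) = 0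
    · rw [h0]; ring
    · linear_combination tr (u ^ k * y) * h k hk h0
  have hrec : ∀ k, tr (u ^ (k + 2) * y) = 2 * e * tr (u ^ (k + 1) * y) - tr (u ^ k * y) := by
    intro k
    have := tr_mul_add_tr_inv_mul u (u ^ (k + 1) * y)
    have e1 : u * (u ^ (k + 1) * y) = u ^ (k + 2) * y := by rw [← mul_assoc, ← pow_succ']
    have e2 : u⁻¹ * (u ^ (k + 1) * y) = u ^ k * y := by rw [pow_succ']; group
    rw [e1, e2, hu] at this
    linear_combination this
  have r0 := hrec 0
  have r1 := hrec 1
  have p0 := hP 0 (by norm_num)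
  have p1 := hP 1 (by norm_num)
  have p2 := hP 2 (by norm_num)
  have p3 := hP 3 (by norm_num)
  norm_num at r0 r1
  rw [r1, r0] at p3
  rw [r0] at p2
  simp only [pow_zero, one_mul, pow_one] at p0 p1 p2 p3
  have key : 2 * 3 * (tr (u * y) - e * tr y) ^ 3 = 0 := by
    rcases he with rfl | rfl
    · linear_combination p3 - 3 * p2 + 3 * p1 - p0
    · linear_combination p3 + 3 * p2 + 3 * p1 + p0
  have := (mul_eq_zero.1 key).resolve_left (mul_ne_zero h2 h3)
  exact hy (sub_eq_zero.1 (pow_eq_zero_iff (by norm_num) |>.1 this))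

variable (P : SymmetricPowers (SL₂ F))

lemma exists_good_trace (h2 : (2 : F) ≠ 0) (h3 : (3 : F) ≠ 0)
    (hgen : ∀ v : Fin 2 → F, v ≠ 0 → ∃ g ∈ P.sets 1, cross v (g.1.mulVec v) ≠ 0) (hcard : 8 < #(P.sets 1)) :
    ∃ g ∈ P.sets 10, tr g ≠ 0 ∧ tr g ^ 2 ≠ 4 := by
  by_cases hpar : ∃ u ∈ P.sets 3, u ≠ 1 ∧ u ≠ negOne ∧ tr u ^ 2 = 4
  · obtain ⟨u, hu, hu1, huN, hut⟩ := hpar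
    obtain ⟨e, he, hue⟩ : ∃ e : F, (e = 1 ∨ e = -1) ∧ tr u = 2 * e := by
      have : (tr u - 2) * (tr u + 2) = 0 := by linear_combination hut
      rcases mul_eq_zero.1 this with h | h
      · exact ⟨1, Or.inl rfl, by linear_combination h⟩
      · exact ⟨-1, Or.inr rfl, by linear_combination h⟩
    have he2 : e ^ 2 = 1 := by rcases he with rfl | rfl <;> ring
    have hut' := hue
    rw [tr_eq] at hut'
    obtain ⟨v, hv, -, hfix⟩ := exists_eigenvector_of_nilpotent
      (c := u.1 - e • (1 : Matrix (Fin 2) (Fin 2) F))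
      (by
        intro h
        have hij : ∀ i j, u.1 i j = e * (1 : Matrix (Fin 2) (Fin 2) F) i j := fun i j => by
          rw [sub_eq_zero.1 h]; simp
        rcases eq_one_or_negOne (z := u) ⟨by simp [hij], by simp [hij], by simp [hij]⟩ with h | h
        · exact hu1 h
        · exact huN h)
      (by simp; linear_combination hut')
      (by simp; linear_combination det_eq u - e * hut' - he2)
    obtain ⟨y, hy, hyv⟩ := hgen v hv
    have hne : tr (u * y) ≠ e * tr y := by
      intro h
      rw [tr_eq, tr_eq, mul_entry, mul_entry] at h
      obtain ⟨a, ha⟩ := hfix y.1 (by simp; linear_combination h)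
      refine hyv ?_
      rw [ha]
      simp [cross]
      ring
    obtain ⟨k, hk, hgood⟩ := exists_good_trace_of_parabolic h2 h3 he hue hne
    refine ⟨u ^ k * y, ?_, hgood⟩
    refine P.mul_mem (m := 3 * k) (n := 1) (by omega) ?_ hy
    exact P.pow_mem hu k
  · by_contra! hbad
    push Not at hpar
    have hzero : ∀ g ∈ P.sets 3, g ≠ 1 → g ≠ negOne → tr g = 0 := by
      intro g hg hg1 hgN
      by_contra h0
      exact hpar g hg hg1 hgN (hbad g (P.mono (by norm_num) hg) h0)
    have hA3 : ∀ g ∈ P.sets 1, g ∈ P.sets 3 := fun g hg => P.mono (by norm_num) hg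
    have hAA : ∀ g ∈ P.sets 1, ∀ k ∈ P.sets 1, g * k ∈ P.sets 3 := fun g hg k hk =>
      P.mul_mem (by norm_num) hg hk
    have hprod : ∀ g k : SL₂ F, tr g = 0 → k ≠ g → k ≠ negOne * g →
        g * k ≠ 1 ∧ g * k ≠ negOne := by
      intro g k hg h1 h2
      refine ⟨fun h => h2 ?_, fun h => h1 ?_⟩
      · rw [← inv_eq_of_tr_eq_zero hg]; exact (inv_eq_of_mul_eq_one_right h).symm
      · have hk : k = g⁻¹ * negOne := by rw [← h]; group
        rw [hk, inv_eq_of_tr_eq_zero hg]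
        apply Subtype.ext
        rw [Matrix.SpecialLinearGroup.coe_mul, Matrix.SpecialLinearGroup.coe_mul, coe_negOne]
        simp
    have pick : ∀ S : Finset (SL₂ F), #S ≤ 8 → ∃ g ∈ P.sets 1, g ∉ S := fun S hS =>
      Finset.exists_mem_notMem_of_card_lt_card (hS.trans_lt hcard)
    obtain ⟨x, hxA, hx⟩ := pick {1, negOne} (Finset.card_le_two.trans (by norm_num))
    simp only [Finset.mem_insert, Finset.mem_singleton, not_or] at hx
    have tx := hzero x (hA3 x hxA) hx.1 hx.2
    obtain ⟨y, hyA, hy⟩ := pick {1, negOne, x, negOne * x}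
      (Finset.card_le_four.trans (by norm_num))
    simp only [Finset.mem_insert, Finset.mem_singleton, not_or] at hy
    obtain ⟨hy1, hy2, hy3, hy4⟩ := hy
    have ty := hzero y (hA3 y hyA) hy1 hy2
    obtain ⟨k1, k2⟩ := hprod x y tx hy3 hy4
    have txy := hzero (x * y) (hAA x hxA y hyA) k1 k2
    obtain ⟨z, hzA, hz⟩ := pick ({1, negOne, x, negOne * x} ∪
      {y, negOne * y, x * y, negOne * (x * y)}) ((Finset.card_union_le _ _).trans
        (add_le_add Finset.card_le_four Finset.card_le_four))
    simp only [Finset.mem_union, Finset.mem_insert, Finset.mem_singleton, not_or] at hz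
    obtain ⟨⟨hz1, hz2, hz3, hz4⟩, hz5, hz6, hz7, hz8⟩ := hz
    have tz := hzero z (hA3 z hzA) hz1 hz2
    obtain ⟨l1, l2⟩ := hprod x z tx hz3 hz4
    obtain ⟨m1, m2⟩ := hprod y z ty hz5 hz6
    obtain ⟨n1, n2⟩ := hprod (x * y) z txy hz7 hz8
    refine not_all_traceless h2 tx ty tz txy (hzero _ (hAA x hxA z hzA) l1 l2)
      (hzero _ (hAA y hyA z hzA) m1 m2) (hzero _ ?_ n1 n2)
    refine P.mul_mem le_rfl ?_ hzA
    exact P.mul_mem le_rfl hxA hyA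

end Escape

end L2Flattening

namespace L2Flattening

section Pivot

variable {F : Type*} [Field F]

lemma exists_cross_ne_zero {A : Set (SL₂ F)} (hA : Subgroup.closure A = ⊤) (v : Fin 2 → F)
    (hv : v ≠ 0) : ∃ g ∈ A, cross v (g.1.mulVec v) ≠ 0 := by
  by_contra! h
  have hline : ∀ g : SL₂ F, ∃ a : F, g.1.mulVec v = a • v := by
    intro g
    have hg : g ∈ Subgroup.closure A := hA ▸ Subgroup.mem_top g
    induction hg using Subgroup.closure_induction with
    | mem g hg => exact smul_of_cross_eq_zero hv (h g hg)
    | one => exact ⟨1, by simp⟩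
    | mul g k _ _ hg hk =>
      obtain ⟨a, ha⟩ := hg
      obtain ⟨b, hb⟩ := hk
      refine ⟨b * a, ?_⟩
      rw [Matrix.SpecialLinearGroup.coe_mul, ← Matrix.mulVec_mulVec, hb, Matrix.mulVec_smul, ha,
        smul_smul]
    | inv g _ hg =>
      obtain ⟨a, ha⟩ := hg
      exact ⟨a⁻¹, mulVec_inv_of_eigen (eigenvalue_ne_zero hv ha) ha⟩
  obtain ⟨a, ha⟩ := hline ⟨!![1, 1; 0, 1], by simp [Matrix.det_fin_two]⟩
  obtain ⟨b, hb⟩ := hline ⟨!![1, 0; 1, 1], by simp [Matrix.det_fin_two]⟩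
  have a0 := congrFun ha 0
  have a1 := congrFun ha 1
  have b0 := congrFun hb 0
  have b1 := congrFun hb 1
  simp [mulVec_entry] at a0 a1 b0 b1
  have hv1 : v 1 = 0 := by
    have : v 1 ^ 2 = 0 := by linear_combination v 1 * a0 - v 0 * a1
    exact pow_eq_zero_iff two_ne_zero |>.1 this
  have hv0 : v 0 = 0 := by
    have : v 0 ^ 2 = 0 := by linear_combination v 0 * b1 - v 1 * b0
    exact pow_eq_zero_iff two_ne_zero |>.1 this
  exact hv (by ext i; fin_cases i <;> assumption)

lemma not_scalar_of_tr {g : SL₂ F} (hg : tr g ^ 2 ≠ 4) :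
    ¬ (g.1 0 1 = 0 ∧ g.1 1 0 = 0 ∧ g.1 0 0 = g.1 1 1) := by
  rintro ⟨k1, -, k3⟩
  have hd := det_eq g
  rw [k1, k3] at hd
  rw [tr_eq, k3] at hg
  exact hg (by linear_combination 4 * hd)

lemma not_scalar_of_ne {g : SL₂ F} (h1 : g ≠ 1) (h2 : g ≠ negOne) :
    ¬ (g.1 0 1 = 0 ∧ g.1 1 0 = 0 ∧ g.1 0 0 = g.1 1 1) := fun h =>
  (eq_one_or_negOne h).elim h1 h2

/-- Centralizers of non-scalar elements are commutative. -/
lemma commute_of_commute {g x y : SL₂ F}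
    (hg : ¬ (g.1 0 1 = 0 ∧ g.1 1 0 = 0 ∧ g.1 0 0 = g.1 1 1)) (hx : g * x = x * g)
    (hy : g * y = y * g) : x * y = y * x := by
  obtain ⟨a, b, h⟩ := exists_eq_of_commute hg hx
  apply Subtype.ext
  have hy' : g.1 * y.1 = y.1 * g.1 := congrArg Subtype.val hy
  rw [Matrix.SpecialLinearGroup.coe_mul, Matrix.SpecialLinearGroup.coe_mul, h, add_mul, mul_add,
    Matrix.smul_mul, Matrix.smul_mul, Matrix.mul_smul, Matrix.mul_smul, hy', one_mul, mul_one]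

/-- A torus contains at most two elements of a given trace. -/
lemma card_commute_tr_le (h2 : (2 : F) ≠ 0) {g : SL₂ F} {s : F}
    (hg : ¬ (g.1 0 1 = 0 ∧ g.1 1 0 = 0 ∧ g.1 0 0 = g.1 1 1))
    (hs : ¬ (tr g ^ 2 = 4 ∧ s ^ 2 = 4)) {S : Finset (SL₂ F)}
    (hS : ∀ y ∈ S, g * y = y * g ∧ tr y = s) : #S ≤ 2 := by
  have key : ∀ y ∈ S, ∃ b : F, y.1 = ((s - b * tr g) / 2) • (1 : Matrix (Fin 2) (Fin 2) F) +
      b • g.1 ∧ b ^ 2 * (4 - tr g ^ 2) = 4 - s ^ 2 := by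
    intro y hy
    obtain ⟨hyg, hys⟩ := hS y hy
    obtain ⟨a, b, hab⟩ := exists_eq_of_commute hg hyg
    have hd := det_eq y
    have hdg := det_eq g
    rw [tr_eq] at hys
    simp only [hab, Matrix.add_apply, Matrix.smul_apply, smul_eq_mul, Matrix.one_apply_eq,
      Matrix.one_apply, Fin.zero_eq_one_iff, one_ne_zero] at hys hd
    norm_num at hys hd
    rw [tr_eq]
    have ha : a = (s - b * (g.1 0 0 + g.1 1 1)) / 2 := by
      rw [eq_div_iff h2]; linear_combination hys
    refine ⟨b, by rw [hab, ha], ?_⟩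
    rw [← hys]
    linear_combination 4 * hd - 4 * b ^ 2 * hdg
  by_contra! h
  obtain ⟨x, hx, y, hy, v, hv, hxy, hxv, hyv⟩ := Finset.two_lt_card.1 h
  obtain ⟨a, ha, ha'⟩ := key x hx
  obtain ⟨b, hb, hb'⟩ := key y hy
  obtain ⟨c, hc, hc'⟩ := key v hv
  have hab : a ≠ b := by rintro rfl; exact hxy (Subtype.ext (ha.trans hb.symm))
  have hac : a ≠ c := by rintro rfl; exact hxv (Subtype.ext (ha.trans hc.symm))
  have hbc : b ≠ c := by rintro rfl; exact hyv (Subtype.ext (hb.trans hc.symm))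
  have ht : 4 - tr g ^ 2 ≠ 0 := by
    intro h0
    rw [h0, mul_zero] at ha'
    exact hs ⟨(sub_eq_zero.1 h0).symm, by linear_combination ha'⟩
  have e1 : (a - b) * ((a + b) * (4 - tr g ^ 2)) = 0 := by linear_combination ha' - hb'
  have e2 : (a - c) * ((a + c) * (4 - tr g ^ 2)) = 0 := by linear_combination ha' - hc'
  have f1 := (mul_eq_zero.1 ((mul_eq_zero.1 e1).resolve_left (sub_ne_zero.2 hab))).resolve_right ht
  have f2 := (mul_eq_zero.1 ((mul_eq_zero.1 e2).resolve_left (sub_ne_zero.2 hac))).resolve_right ht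
  exact hbc (by linear_combination f1 - f2)

/-- A large subset of a torus contains an element of nonexceptional trace. -/
lemma exists_good_of_commute (h2 : (2 : F) ≠ 0) {g : SL₂ F} (hg : tr g ^ 2 ≠ 4)
    {S : Finset (SL₂ F)} (hS : ∀ y ∈ S, g * y = y * g) (hcard : 6 < #S) :
    ∃ y ∈ S, tr y ≠ 0 ∧ tr y ^ 2 ≠ 4 := by
  by_contra! h
  have hmap : ∀ y ∈ S, tr y ∈ ({0, 2, -2} : Finset F) := by
    intro y hy
    simp only [Finset.mem_insert, Finset.mem_singleton]
    by_cases h0 : tr y = 0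
    · exact Or.inl h0
    · right
      have : (tr y - 2) * (tr y + 2) = 0 := by linear_combination h y hy h0
      rcases mul_eq_zero.1 this with h | h
      · exact Or.inl (sub_eq_zero.1 h)
      · exact Or.inr (eq_neg_of_add_eq_zero_left h)
  have h3 := Finset.card_le_mul_card_image_of_maps_to hmap 2 fun s _ =>
    card_commute_tr_le h2 (not_scalar_of_tr hg) (fun h => hg h.1) fun y hy =>
      ⟨hS y (Finset.mem_filter.1 hy).1, (Finset.mem_filter.1 hy).2⟩
  have h4 : #({0, 2, -2} : Finset F) ≤ 3 := Finset.card_le_three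
  omega

lemma card_centralizer_le [Fintype F] [Fintype (SL₂ F)] (h2 : (2 : F) ≠ 0) {g : SL₂ F}
    (hg : tr g ^ 2 ≠ 4) : #{y : SL₂ F | g * y = y * g} ≤ 2 * Fintype.card F := by
  refine Finset.card_le_mul_card_image_of_maps_to (t := (Finset.univ : Finset F)) (f := tr)
    (fun _ _ => Finset.mem_univ _) 2 fun s _ => ?_
  exact card_commute_tr_le h2 (not_scalar_of_tr hg) (fun h => hg h.1) fun y hy =>
    ⟨(Finset.mem_filter.1 (Finset.mem_filter.1 hy).1).2, (Finset.mem_filter.1 hy).2⟩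

/-- Conjugates of a fixed element meeting the centralizer of `y`. -/
lemma card_conj_commute_le [Fintype F] [Fintype (SL₂ F)] (h2 : (2 : F) ≠ 0) {g y : SL₂ F}
    (hg : tr g ^ 2 ≠ 4) (hy1 : y ≠ 1) (hy2 : y ≠ negOne) :
    #{x : SL₂ F | y * (x * g * x⁻¹) = x * g * x⁻¹ * y} ≤ 4 * Fintype.card F := by
  set S : Finset (SL₂ F) := {x : SL₂ F | y * (x * g * x⁻¹) = x * g * x⁻¹ * y} with hS
  have himg : #(S.image fun x => x * g * x⁻¹) ≤ 2 := by
    refine card_commute_tr_le h2 (s := tr g) (not_scalar_of_ne hy1 hy2) (fun h => hg h.2) ?_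
    intro h hh
    obtain ⟨x, hx, rfl⟩ := Finset.mem_image.1 hh
    exact ⟨(Finset.mem_filter.1 hx).2, tr_conj _ _⟩
  refine (Finset.card_le_mul_card_image S (2 * Fintype.card F) ?_).trans
    ((Nat.mul_le_mul_left _ himg).trans (by linarith))
  intro h hh
  obtain ⟨x, -, rfl⟩ := Finset.mem_image.1 hh
  refine le_trans ?_ (card_centralizer_le h2 hg)
  refine Finset.card_le_card_of_injOn (fun z => x⁻¹ * z) ?_ (mul_right_injective _).injOn
  intro z hz
  have hz' := (Finset.mem_filter.1 hz).2
  simp only [Finset.coe_filter, Finset.mem_univ, true_and, Set.mem_ofPred_eq]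
  have : z * g * z⁻¹ * z = x * g * x⁻¹ * z := by rw [hz']
  rw [inv_mul_cancel_right] at this
  rw [mul_assoc x⁻¹ z g, this]
  group

end Pivot

end L2Flattening

namespace L2Flattening

section Growth

variable {F : Type*} [Field F] (P : SymmetricPowers (SL₂ F))

/-- A good element of `P.sets 10` has many commuting elements in `P.sets 2`. -/
lemma card_pow_three_le_commute (h2 : (2 : F) ≠ 0)
    (hgen : Subgroup.closure (P.sets 1 : Set (SL₂ F)) = ⊤) {g : SL₂ F} (hg : g ∈ P.sets 10)
    (hg0 : tr g ≠ 0) (hg4 : tr g ^ 2 ≠ 4) :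
    #(P.sets 1) ^ 3 ≤ 1728 * #(P.sets 25) ^ 2 * #{y ∈ P.sets 2 | g * y = y * g} ^ 3 := by
  have hX : #{x ∈ P.sets 12 | tr x = tr g} ^ 3 ≤ 1728 * #(P.sets 25) ^ 2 := by
    refine card_trace_fibre_le (P := P.sets 12) (Q := P.sets 25) h2 (fun x hx y hy => ?_) (fun v hv => ?_) hg0 hg4
    · exact P.mul_mem (by norm_num) hy (P.inv_mem hx)
    · obtain ⟨k, hk, hkv⟩ := exists_cross_ne_zero hgen v hv
      refine ⟨k, fun y hy z hz => ?_, hkv⟩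
      exact P.mul_mem (by norm_num)
        (P.mul_mem le_rfl hy hk) hz
  have hmap : ∀ a ∈ P.sets 1, a * g * a⁻¹ ∈ ({x ∈ P.sets 12 | tr x = tr g} : Finset (SL₂ F)) := by
    intro a ha
    rw [Finset.mem_filter]
    refine ⟨?_, tr_conj a g⟩
    exact P.mul_mem (by norm_num)
      (P.mul_mem le_rfl ha hg)
      (P.inv_mem ha)
  have hle := Finset.card_le_mul_card_image_of_maps_to hmap #{y ∈ P.sets 2 | g * y = y * g} ?_
  · calc #(P.sets 1) ^ 3 ≤ (#{y ∈ P.sets 2 | g * y = y * g} * #{x ∈ P.sets 12 | tr x = tr g}) ^ 3 :=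
        Nat.pow_le_pow_left hle 3
      _ = #{x ∈ P.sets 12 | tr x = tr g} ^ 3 * #{y ∈ P.sets 2 | g * y = y * g} ^ 3 := by
        rw [mul_pow, mul_comm]
      _ ≤ _ := Nat.mul_le_mul_right _ hX
  · intro h _
    rcases ((P.sets 1).filter fun a => a * g * a⁻¹ = h).eq_empty_or_nonempty with he | ⟨a, ha⟩
    · rw [he, Finset.card_empty]; exact Nat.zero_le _
    obtain ⟨haA, hah⟩ := Finset.mem_filter.1 ha
    refine Finset.card_le_card_of_injOn (fun b => a⁻¹ * b) ?_ (mul_right_injective _).injOn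
    intro b hb
    obtain ⟨hbA, hbh⟩ := Finset.mem_filter.1 hb
    rw [Finset.mem_coe, Finset.mem_filter]
    constructor
    · exact P.mul_mem le_rfl (P.inv_mem haA)
        hbA
    · have : a * g * a⁻¹ * b = b * g * b⁻¹ * b := by rw [hah, hbh]
      calc g * (a⁻¹ * b) = a⁻¹ * (a * g * a⁻¹ * b) := by group
        _ = a⁻¹ * (b * g * b⁻¹ * b) := by rw [this]
        _ = a⁻¹ * b * g := by group

/-- A generating set of small growth is large. -/
theorem exists_card_mul_le_of_closure_eq_top [Fintype F] [Fintype (SL₂ F)] (h2 : (2 : F) ≠ 0)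
    (h3 : (3 : F) ≠ 0)
    (hgen : Subgroup.closure (P.sets 1 : Set (SL₂ F)) = ⊤)
    (hcard : 1728 * 9 ^ 3 * #(P.sets 25) ^ 2 < #(P.sets 1) ^ 3) :
    ∃ r : ℕ, 10 ≤ r ∧ #(P.sets 1) ^ 3 ≤ 1728 * #(P.sets 25) ^ 2 * r ^ 3 ∧
      Fintype.card (SL₂ F) * (r - 2) ≤ 4 * Fintype.card F * #(P.sets 2) := by
  have hA25 : #(P.sets 1) ≤ #(P.sets 25) :=
    Finset.card_le_card fun x hx => P.mono (by norm_num) hx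
  have h8 : 8 < #(P.sets 1) := by
    by_contra! h
    have h5 : #(P.sets 1) ^ 2 ≤ #(P.sets 25) ^ 2 := Nat.pow_le_pow_left hA25 2
    nlinarith
  have hbig : ∀ g ∈ P.sets 10, tr g ≠ 0 → tr g ^ 2 ≠ 4 → 10 ≤ #{y ∈ P.sets 2 | g * y = y * g} := by
    intro g hg hg0 hg4
    have h := card_pow_three_le_commute P h2 hgen hg hg0 hg4
    by_contra! hlt
    have h9 : #{y ∈ P.sets 2 | g * y = y * g} ^ 3 ≤ 9 ^ 3 := Nat.pow_le_pow_left (by omega) 3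
    have := Nat.mul_le_mul_left (1728 * #(P.sets 25) ^ 2) h9
    linarith
  obtain ⟨g₀, hg₀, hg₀0, hg₀4⟩ :=
    exists_good_trace P h2 h3 (fun v hv => exists_cross_ne_zero hgen v hv) h8
  have hconj4 : ∀ x : SL₂ F, tr (x * g₀ * x⁻¹) ^ 2 ≠ 4 := fun x => by rwa [tr_conj]
  have hpivot : ∀ x : SL₂ F, ∃ g ∈ P.sets 10, tr g ≠ 0 ∧ tr g ^ 2 ≠ 4 ∧
      g * (x * g₀ * x⁻¹) = x * g₀ * x⁻¹ * g := by
    have hstep : ∀ a ∈ P.sets 1, ∀ x : SL₂ F, (∃ g ∈ P.sets 10, tr g ≠ 0 ∧ tr g ^ 2 ≠ 4 ∧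
        g * (x * g₀ * x⁻¹) = x * g₀ * x⁻¹ * g) → ∃ g ∈ P.sets 10, tr g ≠ 0 ∧ tr g ^ 2 ≠ 4 ∧
        g * (a * x * g₀ * (a * x)⁻¹) = a * x * g₀ * (a * x)⁻¹ * g := by
      rintro a ha x ⟨g, hg, hg0, hg4, hgx⟩
      obtain ⟨y, hy, hy0, hy4⟩ := exists_good_of_commute h2 hg4
        (S := {y ∈ P.sets 2 | g * y = y * g}) (fun y hy => (Finset.mem_filter.1 hy).2)
        (lt_of_lt_of_le (by norm_num) (hbig g hg hg0 hg4))
      obtain ⟨hyA, hyg⟩ := Finset.mem_filter.1 hy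
      have hyx := commute_of_commute (not_scalar_of_tr hg4) hyg hgx
      refine ⟨a * y * a⁻¹, ?_, by rwa [tr_conj], by rwa [tr_conj], ?_⟩
      · exact P.mul_mem (by norm_num)
          (P.mul_mem le_rfl ha hyA)
          (P.inv_mem ha)
      · calc a * y * a⁻¹ * (a * x * g₀ * (a * x)⁻¹) = a * (y * (x * g₀ * x⁻¹)) * a⁻¹ := by group
          _ = a * (x * g₀ * x⁻¹ * y) * a⁻¹ := by rw [hyx]
          _ = _ := by group
    intro x
    have hx : x ∈ Subgroup.closure (P.sets 1 : Set (SL₂ F)) := hgen ▸ Subgroup.mem_top x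
    induction hx using Subgroup.closure_induction_left with
    | one => exact ⟨g₀, hg₀, hg₀0, hg₀4, by group⟩
    | mul_left a ha x _ hx => exact hstep a ha x hx
    | inv_mul_cancel a ha x _ hx =>
      exact hstep a⁻¹ (P.inv_mem ha) x hx
  set C : SL₂ F → Finset (SL₂ F) := fun x => {y ∈ P.sets 2 | y * (x * g₀ * x⁻¹) = x * g₀ * x⁻¹ * y}
    with hC
  obtain ⟨x, -, hx⟩ := Finset.exists_min_image Finset.univ (fun x => #(C x))
    ⟨(1 : SL₂ F), Finset.mem_univ _⟩
  obtain ⟨g, hg, hg0, hg4, hgx⟩ := hpivot x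
  have hsub : ({y ∈ P.sets 2 | g * y = y * g} : Finset (SL₂ F)) ⊆ C x := by
    intro y hy
    obtain ⟨hyA, hyg⟩ := Finset.mem_filter.1 hy
    exact Finset.mem_filter.2 ⟨hyA, commute_of_commute (not_scalar_of_tr hg4) hyg hgx⟩
  refine ⟨#(C x), (hbig g hg hg0 hg4).trans (Finset.card_le_card hsub),
    (card_pow_three_le_commute P h2 hgen hg hg0 hg4).trans
      (Nat.mul_le_mul_left _ (Nat.pow_le_pow_left (Finset.card_le_card hsub) 3)), ?_⟩
  have hdouble := Finset.sum_card_bipartiteAbove_eq_sum_card_bipartiteBelow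
    (s := (Finset.univ : Finset (SL₂ F))) (t := P.sets 2 \ {1, negOne})
    (fun x y => y * (x * g₀ * x⁻¹) = x * g₀ * x⁻¹ * y)
  have hlow : Fintype.card (SL₂ F) * (#(C x) - 2) ≤ ∑ z : SL₂ F,
      #(Finset.bipartiteAbove (fun x y => y * (x * g₀ * x⁻¹) = x * g₀ * x⁻¹ * y)
        (P.sets 2 \ {1, negOne}) z) := by
    rw [← Finset.card_univ, ← smul_eq_mul]
    refine Finset.card_nsmul_le_sum _ _ _ fun z hz => ?_
    have : C z \ {1, negOne} ⊆ Finset.bipartiteAbove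
        (fun x y => y * (x * g₀ * x⁻¹) = x * g₀ * x⁻¹ * y) (P.sets 2 \ {1, negOne}) z := by
      intro y hy
      obtain ⟨hyC, hyn⟩ := Finset.mem_sdiff.1 hy
      obtain ⟨hyA, hyc⟩ := Finset.mem_filter.1 hyC
      exact Finset.mem_filter.2 ⟨Finset.mem_sdiff.2 ⟨hyA, hyn⟩, hyc⟩
    refine le_trans ?_ (Finset.card_le_card this)
    refine le_trans ?_ (Finset.le_card_sdiff _ _)
    exact (Nat.sub_le_sub_right (hx z hz) 2).trans (Nat.sub_le_sub_left Finset.card_le_two _)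
  rw [hdouble] at hlow
  refine hlow.trans ?_
  refine (Finset.sum_le_card_nsmul _ _ (4 * Fintype.card F) fun y hy => ?_).trans ?_
  · have hy' := (Finset.mem_sdiff.1 hy).2
    simp only [Finset.mem_insert, Finset.mem_singleton, not_or] at hy'
    exact card_conj_commute_le h2 hg₀4 hy'.1 hy'.2
  · rw [smul_eq_mul, mul_comm]
    exact Nat.mul_le_mul_left _ (Finset.card_le_card Finset.sdiff_subset)

end Growth

end L2Flattening

namespace L2Flattening

section Cardinality

variable {F : Type*} [Field F] [Fintype F] [Fintype (SL₂ F)]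

lemma mul_sq_card_le_card :
    (Fintype.card F - 1) * Fintype.card F ^ 2 ≤ Fintype.card (SL₂ F) := by
  have h : Fintype.card (Fˣ × F × F) = (Fintype.card F - 1) * Fintype.card F ^ 2 := by
    rw [Fintype.card_prod, Fintype.card_prod, Fintype.card_units, sq]
  rw [← h]
  refine Fintype.card_le_of_injective (fun q : Fˣ × F × F =>
    (⟨!![(q.1 : F), q.2.1; q.2.2, (1 + q.2.1 * q.2.2) / q.1], by
      have := q.1.ne_zero
      rw [Matrix.det_fin_two_of]
      field_simp
      ring⟩ : SL₂ F)) ?_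
  rintro ⟨a, b, c⟩ ⟨a', b', c'⟩ h
  have e := congrArg Subtype.val h
  have e00 := congrFun (congrFun e 0) 0
  have e01 := congrFun (congrFun e 0) 1
  have e10 := congrFun (congrFun e 1) 0
  simp at e00 e01 e10
  rw [Units.ext e00, e01, e10]

lemma card_le_two_mul_card_pow : Fintype.card (SL₂ F) ≤ 2 * Fintype.card F ^ 3 := by
  have h : Fintype.card ((F × F × F) ⊕ (F × F × F)) = 2 * Fintype.card F ^ 3 := by
    rw [Fintype.card_sum, Fintype.card_prod, Fintype.card_prod]
    ring
  rw [← h]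
  refine Fintype.card_le_of_injective (fun g : SL₂ F => if g.1 0 0 = 0 then
    Sum.inl (g.1 0 1, g.1 1 0, g.1 1 1) else Sum.inr (g.1 0 0, g.1 0 1, g.1 1 0)) ?_
  intro g k h
  have hg := det_eq g
  have hk := det_eq k
  by_cases hg0 : g.1 0 0 = 0 <;> by_cases hk0 : k.1 0 0 = 0 <;> simp [hg0, hk0] at h
  · exact ext_entries (hg0.trans hk0.symm) h.1 h.2.1 h.2.2
  · obtain ⟨h1, h2, h3⟩ := h
    refine ext_entries h1 h2 h3 (mul_left_cancel₀ hk0 ?_)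
    rw [h1, h2, h3] at hg
    linear_combination hg - hk

/-- A generating set of small growth in `SL₂(F)` is almost the whole group. -/
theorem card_pow_six_le (h2 : (2 : F) ≠ 0) (h3 : (3 : F) ≠ 0) (P : SymmetricPowers (SL₂ F))
    (hgen : Subgroup.closure (P.sets 1 : Set (SL₂ F)) = ⊤) {K : ℝ}
    (hK : (#(P.sets 25) : ℝ) ≤ K * #(P.sets 1)) (hbig : 1728 * 9 ^ 3 * K ^ 2 < #(P.sets 1)) :
    (Fintype.card F : ℝ) ^ 6 ≤ 1728000 * K ^ 5 * (#(P.sets 1) : ℝ) ^ 2 := by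
  set h : ℝ := (#(P.sets 1) : ℝ) with hh
  set q : ℝ := (Fintype.card F : ℝ) with hq
  have hpos : 0 < h := lt_of_le_of_lt (by positivity) hbig
  have hK0 : 0 ≤ K := by
    by_contra! hneg
    have : (0 : ℝ) ≤ #(P.sets 25) := Nat.cast_nonneg _
    nlinarith
  have hsq : (#(P.sets 25) : ℝ) ^ 2 ≤ K ^ 2 * h ^ 2 := by
    rw [← mul_pow]
    exact pow_le_pow_left₀ (Nat.cast_nonneg _) hK 2
  obtain ⟨r, hr, hr1, hr2⟩ := exists_card_mul_le_of_closure_eq_top P h2 h3 hgen (by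
    have : (1728 * 9 ^ 3 * #(P.sets 25) ^ 2 : ℝ) < (#(P.sets 1) : ℝ) ^ 3 := by
      calc (1728 * 9 ^ 3 * #(P.sets 25) ^ 2 : ℝ) ≤ 1728 * 9 ^ 3 * (K ^ 2 * h ^ 2) :=
            mul_le_mul_of_nonneg_left hsq (by norm_num)
        _ = 1728 * 9 ^ 3 * K ^ 2 * h ^ 2 := by ring
        _ < h * h ^ 2 := mul_lt_mul_of_pos_right hbig (by positivity)
        _ = h ^ 3 := by ring
    exact_mod_cast this)
  have hr' : (10 : ℝ) ≤ r := by exact_mod_cast hr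
  have hr1' : h ≤ 1728 * K ^ 2 * r ^ 3 := by
    have e : h ^ 3 ≤ 1728 * (#(P.sets 25) : ℝ) ^ 2 * (r : ℝ) ^ 3 := by
      rw [hh]; exact_mod_cast hr1
    have e2 : h ^ 2 * h ≤ h ^ 2 * (1728 * K ^ 2 * r ^ 3) := by
      calc h ^ 2 * h = h ^ 3 := by ring
        _ ≤ 1728 * (#(P.sets 25) : ℝ) ^ 2 * (r : ℝ) ^ 3 := e
        _ ≤ 1728 * (K ^ 2 * h ^ 2) * (r : ℝ) ^ 3 := by gcongr
        _ = _ := by ring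
    exact le_of_mul_le_mul_left e2 (by positivity)
  have hq2 : (2 : ℝ) ≤ q := by
    rw [hq]
    exact_mod_cast Fintype.one_lt_card (α := F)
  have hG : q ^ 3 / 2 ≤ Fintype.card (SL₂ F) := by
    have e := mul_sq_card_le_card (F := F)
    have e' : (q - 1) * q ^ 2 ≤ Fintype.card (SL₂ F) := by
      have h1 : 1 ≤ Fintype.card F := Fintype.card_pos
      have : ((Fintype.card F - 1 : ℕ) : ℝ) * (Fintype.card F : ℝ) ^ 2 ≤
          Fintype.card (SL₂ F) := by exact_mod_cast e
      rwa [Nat.cast_sub h1, Nat.cast_one] at this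
    nlinarith [sq_nonneg q]
  have hr2' : (Fintype.card (SL₂ F) : ℝ) * (r - 2) ≤ 4 * q * (K * h) := by
    have e : (Fintype.card (SL₂ F) : ℝ) * ((r - 2 : ℕ) : ℝ) ≤ 4 * q * #(P.sets 2) := by
      rw [hq]; exact_mod_cast hr2
    rw [Nat.cast_sub (by omega)] at e
    refine e.trans (mul_le_mul_of_nonneg_left (le_trans ?_ hK) (by positivity))
    exact_mod_cast Finset.card_le_card (P.mono (by norm_num))
  have hqr : q ^ 2 * r ≤ 10 * (K * h) := by
    have e1 : q ^ 3 / 2 * (4 / 5 * r) ≤ 4 * q * (K * h) := by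
      refine le_trans (mul_le_mul hG (by linarith) (by positivity) (Nat.cast_nonneg _)) hr2'
    have e2 : q * (q ^ 2 * r) ≤ q * (10 * (K * h)) := by linarith
    exact le_of_mul_le_mul_left e2 (by linarith)
  have hcube : q ^ 6 * r ^ 3 ≤ 1000 * K ^ 3 * h ^ 3 := by
    have := pow_le_pow_left₀ (by positivity) hqr 3
    calc q ^ 6 * r ^ 3 = (q ^ 2 * r) ^ 3 := by ring
      _ ≤ _ := this
      _ = _ := by ring
  have hfin : q ^ 6 * h ≤ 1728000 * K ^ 5 * h ^ 2 * h := by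
    calc q ^ 6 * h ≤ q ^ 6 * (1728 * K ^ 2 * r ^ 3) := by gcongr
      _ = 1728 * K ^ 2 * (q ^ 6 * r ^ 3) := by ring
      _ ≤ 1728 * K ^ 2 * (1000 * K ^ 3 * h ^ 3) := by gcongr
      _ = _ := by ring
  exact le_of_mul_le_mul_right hfin hpos

end Cardinality

end L2Flattening

namespace L2Flattening

section Spectral

variable {G : Type*} [Group G] [Fintype G]

lemma convR_convR (f g : G → ℝ) (φ : G → ℂ) : convR f (convR g φ) = convR (conv f g) φ := by
  funext x
  simp only [convR, conv, mul_sum, Complex.ofReal_sum, Complex.ofReal_mul, sum_mul]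
  conv_rhs => rw [sum_comm]
  refine sum_congr rfl fun y _ => ?_
  rw [← Equiv.sum_comp (Equiv.mulLeft y⁻¹)]
  refine sum_congr rfl fun z _ => ?_
  simp only [Equiv.coe_mulLeft, mul_inv_rev, inv_inv, mul_assoc, mul_inv_cancel_left]

lemma sum_convR (f : G → ℝ) (φ : G → ℂ) :
    ∑ x, convR f φ x = (∑ x, (f x : ℂ)) * ∑ x, φ x := by
  unfold convR
  rw [sum_comm, sum_mul]
  refine sum_congr rfl fun y _ => ?_
  rw [← mul_sum]
  congr 1
  exact Equiv.sum_comp (Equiv.mulLeft y⁻¹) φ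

lemma sum_conj_convR_mul (f : G → ℝ) (φ ψ : G → ℂ) :
    ∑ x, starRingEnd ℂ (convR f φ x) * ψ x =
      ∑ x, starRingEnd ℂ (φ x) * convR (fun y => f y⁻¹) ψ x := by
  simp only [convR, map_sum, map_mul, Complex.conj_ofReal, sum_mul, mul_sum]
  rw [sum_comm]
  conv_rhs => rw [sum_comm, ← Equiv.sum_comp (Equiv.inv G)]
  refine sum_congr rfl fun y _ => ?_
  rw [← Equiv.sum_comp (Equiv.mulLeft y)]
  refine sum_congr rfl fun x _ => ?_
  simp only [Equiv.coe_mulLeft, Equiv.inv_apply, inv_inv, inv_mul_cancel_left]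
  ring

lemma sum_norm_convR_sq (f : G → ℝ) (φ : G → ℂ) :
    ∑ x, ‖convR f φ x‖ ^ 2 =
      (∑ x, starRingEnd ℂ (φ x) * convR (conv (fun y => f y⁻¹) f) φ x).re := by
  rw [← convR_convR, ← sum_conj_convR_mul, Complex.re_sum]
  refine sum_congr rfl fun x _ => ?_
  rw [mul_comm, Complex.mul_conj, Complex.ofReal_re, Complex.normSq_eq_norm_sq]

/-- The functions of mean zero, as a subspace of the space of all functions on `G`. -/
def meanZero (G : Type*) [Fintype G] : Submodule ℂ (EuclideanSpace ℂ G) where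
  carrier := {v | ∑ x, v x = 0}
  add_mem' := fun {a b} ha hb => by
    have ha' : ∑ x, a x = 0 := ha
    have hb' : ∑ x, b x = 0 := hb
    change ∑ x, (a x + b x) = 0
    rw [sum_add_distrib, ha', hb', add_zero]
  zero_mem' := by
    change ∑ _x : G, (0 : ℂ) = 0
    simp
  smul_mem' := fun c a ha => by
    have ha' : ∑ x, a x = 0 := ha
    change ∑ x, c * a x = 0
    rw [← mul_sum, ha', mul_zero]

/-- Convolution by a weight, acting on functions of mean zero. -/
noncomputable def convOperator (f : G → ℝ) : meanZero G →ₗ[ℂ] meanZero G where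
  toFun v := ⟨WithLp.toLp 2 (convR f v.1.ofLp), by
    have hv : ∑ x, v.1.ofLp x = 0 := v.2
    change ∑ x, convR f v.1.ofLp x = 0
    rw [sum_convR, hv, mul_zero]⟩
  map_add' v w := by
    ext x
    simp [convR, mul_add, sum_add_distrib]
  map_smul' c v := by
    ext x
    simp [convR, mul_sum, mul_left_comm]

lemma inner_convOperator (f : G → ℝ) (v w : meanZero G) :
    inner ℂ (convOperator f v) w =
      ∑ x, starRingEnd ℂ (convR f v.1.ofLp x) * w.1.ofLp x := by
  rw [Submodule.coe_inner, PiLp.inner_apply]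
  refine sum_congr rfl fun x _ => ?_
  rw [RCLike.inner_apply, mul_comm]
  rfl

/-- The largest eigenvalue of a symmetric convolution operator on functions of mean zero. -/
lemma exists_eigenvector {f : G → ℝ} (hf : ∀ x, f x⁻¹ = f x) {φ₀ : G → ℂ} (h0 : φ₀ ≠ 0)
    (hm : ∑ x, φ₀ x = 0) :
    ∃ (c : ℝ) (ψ : G → ℂ), ψ ≠ 0 ∧ ∑ x, ψ x = 0 ∧ (∀ x, convR f ψ x = c * ψ x) ∧
      ∀ φ : G → ℂ, ∑ x, φ x = 0 →
        (∑ x, starRingEnd ℂ (φ x) * convR f φ x).re ≤ c * ∑ x, ‖φ x‖ ^ 2 := by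
  have hsymm : LinearMap.IsSymmetric (𝕜 := ℂ) (E := meanZero G) (convOperator f) := by
    intro v w
    rw [inner_convOperator, sum_conj_convR_mul, Submodule.coe_inner, PiLp.inner_apply]
    refine sum_congr rfl fun x _ => ?_
    rw [RCLike.inner_apply, mul_comm]
    simp only [hf]
    rfl
  have : Nontrivial (meanZero G) := by
    refine ⟨⟨⟨WithLp.toLp 2 φ₀, hm⟩, 0, fun h => h0 ?_⟩⟩
    have h' := congrArg (fun v : meanZero G => v.1.ofLp) h
    exact h'
  obtain ⟨v, hv⟩ := hsymm.hasEigenvalue_iSup_of_finiteDimensional.exists_hasEigenvector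
  refine ⟨(⨆ x : { x : meanZero G // x ≠ 0 },
      RCLike.re (inner ℂ (convOperator f x) (x : meanZero G)) / ‖(x : meanZero G)‖ ^ 2 : ℝ),
    v.1.ofLp, ?_, v.2, ?_, ?_⟩
  · intro h
    apply hv.2
    ext x
    exact congrFun h x
  · intro x
    have h := congrArg (fun v : meanZero G => v.1.ofLp x) hv.apply_eq_smul
    exact h
  · intro φ hφ
    by_cases hφ0 : φ = 0
    · simp [hφ0]
    set w : meanZero G := ⟨WithLp.toLp 2 φ, hφ⟩ with hw
    have hw0 : w ≠ 0 := fun h => hφ0 (congrArg (fun v : meanZero G => v.1.ofLp) h)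
    have hnorm : ‖w‖ ^ 2 = ∑ x, ‖φ x‖ ^ 2 := by
      rw [Submodule.coe_norm, EuclideanSpace.norm_sq_eq]
    have hpos : 0 < ‖w‖ ^ 2 := pow_pos (norm_pos_iff.2 hw0) 2
    have hin : RCLike.re (inner ℂ (convOperator f w) w) =
        (∑ x, starRingEnd ℂ (φ x) * convR f φ x).re := by
      rw [inner_convOperator, sum_conj_convR_mul]
      simp only [hf]
      rfl
    rw [← hnorm, ← hin, ← div_le_iff₀ hpos]
    let T : meanZero G →L[ℂ] meanZero G := LinearMap.toContinuousLinearMap (convOperator f)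
    have hT : ∀ x : meanZero G, T x = convOperator f x := fun x => rfl
    have hbdd : ∀ x : meanZero G,
        RCLike.re (inner ℂ (convOperator f x) x) / ‖x‖ ^ 2 ≤ ‖T‖ := by
      intro x
      have h := ContinuousLinearMap.rayleighQuotient_le_norm (𝕜 := ℂ) (E := meanZero G) T x
      rw [ContinuousLinearMap.rayleighQuotient, ContinuousLinearMap.reApplyInnerSelf_apply, hT] at h
      exact (le_abs_self _).trans h
    refine le_ciSup (f := fun x : { x : meanZero G // x ≠ 0 } =>
      RCLike.re (inner ℂ (convOperator f x) (x : meanZero G)) / ‖(x : meanZero G)‖ ^ 2)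
      ⟨‖T‖, ?_⟩ ⟨w, hw0⟩
    rintro _ ⟨x, rfl⟩
    exact hbdd x.1

/-- If an operator of convolution has many orthogonal eigenfunctions with the same eigenvalue, then
this eigenvalue is small. -/
lemma card_mul_sq_le {ι : Type*} [Fintype ι] (f : G → ℝ) (c : ℝ) (φ : ι → G → ℂ)
    (h0 : ∀ i, φ i ≠ 0) (hφ : ∀ i x, convR f (φ i) x = c * φ i x)
    (horth : ∀ i j, i ≠ j → ∑ x, starRingEnd ℂ (φ i x) * φ j x = 0) :
    Fintype.card ι * c ^ 2 ≤ Fintype.card G * ∑ x, f x ^ 2 := by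
  let e : ι → EuclideanSpace ℂ G := fun i => WithLp.toLp 2 (φ i)
  have he0 : ∀ i, 0 < ‖e i‖ := fun i => norm_pos_iff.2 fun h =>
    h0 i (congrArg (fun v : EuclideanSpace ℂ G => v.ofLp) h)
  let b : ι → EuclideanSpace ℂ G := fun i => ((‖e i‖⁻¹ : ℝ) : ℂ) • e i
  have hb : Orthonormal ℂ b := by
    refine ⟨fun i => ?_, fun i j hij => ?_⟩
    · rw [norm_smul, Complex.norm_real, Real.norm_of_nonneg (inv_nonneg.2 (he0 i).le),
        inv_mul_cancel₀ (he0 i).ne']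
    · have h : inner ℂ (e i) (e j) = 0 := by
        rw [PiLp.inner_apply, ← horth i j hij]
        exact sum_congr rfl fun x _ => by rw [RCLike.inner_apply, mul_comm]
      simp only [b, inner_smul_left, inner_smul_right, h, mul_zero]
  have hx : ∀ x : G, ∑ i, c ^ 2 * ‖φ i x‖ ^ 2 * (‖e i‖ ^ 2)⁻¹ ≤ ∑ y, f y ^ 2 := by
    intro x
    let v : EuclideanSpace ℂ G := WithLp.toLp 2 fun y => (f (x * y⁻¹) : ℂ)
    have hv : ‖v‖ ^ 2 = ∑ y, f y ^ 2 := by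
      rw [EuclideanSpace.norm_sq_eq, ← Equiv.sum_comp ((Equiv.inv G).trans (Equiv.mulLeft x))
        (fun y => f y ^ 2)]
      refine sum_congr rfl fun y _ => ?_
      simp [v]
    have hin : ∀ i, inner ℂ v (e i) = c * φ i x := by
      intro i
      rw [← hφ i x, PiLp.inner_apply]
      unfold convR
      conv_rhs => rw [← Equiv.sum_comp ((Equiv.inv G).trans (Equiv.mulLeft x))]
      refine sum_congr rfl fun y _ => ?_
      simp [v, e, mul_comm]
    have h := hb.sum_inner_products_le (s := univ) v
    rw [hv] at h
    refine le_trans (le_of_eq ?_) h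
    refine sum_congr rfl fun i _ => ?_
    rw [norm_inner_symm, inner_smul_right, hin, norm_mul, norm_mul, Complex.norm_real,
      Complex.norm_real, Real.norm_of_nonneg (inv_nonneg.2 (he0 i).le), Real.norm_eq_abs, mul_pow,
      mul_pow, sq_abs, inv_pow]
    ring
  have h := sum_le_sum fun x (_ : x ∈ (univ : Finset G)) => hx x
  rw [sum_const, nsmul_eq_mul, card_univ, sum_comm] at h
  refine le_trans (le_of_eq ?_) h
  have hi : ∀ i, ∑ x, c ^ 2 * ‖φ i x‖ ^ 2 * (‖e i‖ ^ 2)⁻¹ = c ^ 2 := by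
    intro i
    rw [← sum_mul, ← mul_sum, mul_assoc, EuclideanSpace.norm_sq_eq, mul_inv_cancel₀, mul_one]
    rw [← EuclideanSpace.norm_sq_eq (e i)]
    exact (pow_pos (he0 i) 2).ne'
  simp [hi]

end Spectral

end L2Flattening

namespace L2Flattening

section Unipotent

variable {F : Type*} [Field F]

/-- The upper unipotent matrix with off-diagonal entry `s`. -/
def upper (s : F) : SL₂ F := ⟨!![1, s; 0, 1], by simp [Matrix.det_fin_two]⟩

/-- The diagonal matrix with entries `a` and `a⁻¹`. -/
def diag (a : Fˣ) : SL₂ F := ⟨!![(a : F), 0; 0, (a⁻¹ : Fˣ)], by simp [Matrix.det_fin_two]⟩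

lemma upper_zero : upper (0 : F) = 1 := by
  apply ext_entries <;> simp [upper]

lemma upper_mul (s t : F) : upper s * upper t = upper (s + t) := by
  apply ext_entries <;> simp only [mul_entry] <;> simp [upper, add_comm]

lemma upper_mul_diag (s : F) (a : Fˣ) :
    upper s * diag a = diag a * upper (s / a ^ 2) := by
  apply ext_entries <;> simp only [mul_entry] <;> simp [upper, diag]
  field_simp

/-- The conjugates of the upper unipotent matrices generate `SL₂(F)`. -/
lemma eq_top_of_upper_mem {S : Subgroup (SL₂ F)}
    (h : ∀ (g : SL₂ F) (s : F), g⁻¹ * upper s * g ∈ S) : S = ⊤ := by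
  have hu : ∀ s, upper s ∈ S := fun s => by simpa using h 1 s
  let w : SL₂ F := ⟨!![0, 1; -1, 0], by simp [Matrix.det_fin_two]⟩
  let l : F → SL₂ F := fun s => ⟨!![1, 0; s, 1], by simp [Matrix.det_fin_two]⟩
  have hl : ∀ s, l s ∈ S := fun s => by
    have h1 : l s = w⁻¹ * upper (-s) * w := by
      obtain ⟨h1, h2, h3, h4⟩ := inv_entries w
      apply ext_entries <;> simp only [mul_entry, h1, h2, h3, h4] <;> simp [l, w, upper]
    rw [h1]
    exact h w (-s)
  have hc : ∀ g : SL₂ F, g.1 1 0 ≠ 0 → g ∈ S := fun g hg => by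
    have hdet := det_eq g
    have h1 : g = upper ((g.1 0 0 - 1) / g.1 1 0) * l (g.1 1 0) * upper ((g.1 1 1 - 1) / g.1 1 0) := by
      apply ext_entries <;> simp only [mul_entry] <;> simp [l, upper] <;> field_simp <;>
        first | (ring; done) | linear_combination -hdet
    rw [h1]
    exact S.mul_mem (S.mul_mem (hu _) (hl _)) (hu _)
  refine (Subgroup.eq_top_iff' S).2 fun g => ?_
  by_cases hg : g.1 1 0 = 0
  · have hdet := det_eq g
    rw [hg, mul_zero, sub_zero] at hdet
    have h1 : g * l 1 ∈ S := by
      refine hc _ ?_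
      simp only [mul_entry, hg]
      simpa [l] using right_ne_zero_of_mul_eq_one hdet
    have h2 := S.mul_mem h1 (S.inv_mem (hl 1))
    rwa [mul_inv_cancel_right] at h2
  · exact hc g hg

variable [Fintype (SL₂ F)]

lemma convR_sum_translates (f : SL₂ F → ℝ) {c : ℝ} {ψ : SL₂ F → ℂ}
    (hψ : ∀ x, convR f ψ x = c * ψ x) {ι : Type*} [Fintype ι] (a : ι → ℂ) (g : ι → SL₂ F)
    (x : SL₂ F) :
    convR f (fun x => ∑ i, a i * ψ (x * g i)) x = c * ∑ i, a i * ψ (x * g i) := by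
  have h : convR f (fun x => ∑ i, a i * ψ (x * g i)) x = ∑ i, a i * convR f ψ (x * g i) := by
    unfold convR
    simp only [mul_sum]
    rw [sum_comm]
    refine sum_congr rfl fun i _ => sum_congr rfl fun y _ => ?_
    rw [mul_assoc]
    ring
  rw [h, mul_sum]
  refine sum_congr rfl fun i _ => ?_
  rw [hψ]
  ring

variable [Fintype F]

/-- Functions transforming by distinct characters under right translation by the upper unipotent
group are orthogonal. -/
lemma sum_conj_mul_eq_zero {χ : AddChar F ℂ} (hχ : χ.IsPrimitive) {j k : F} (hjk : j ≠ k)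
    {φ ψ : SL₂ F → ℂ} (hφ : ∀ x s, φ (x * upper s) = χ (s * j) * φ x)
    (hψ : ∀ x s, ψ (x * upper s) = χ (s * k) * ψ x) :
    ∑ x, starRingEnd ℂ (φ x) * ψ x = 0 := by
  have hs : ∀ s : F, ∑ x, starRingEnd ℂ (φ x) * ψ x =
      χ (s * (k - j)) * ∑ x, starRingEnd ℂ (φ x) * ψ x := by
    intro s
    conv_lhs => rw [← Equiv.sum_comp (Equiv.mulRight (upper s))]
    rw [mul_sum]
    refine sum_congr rfl fun x _ => ?_
    simp only [Equiv.coe_mulRight, hφ, hψ, map_mul]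
    rw [← AddChar.map_neg_eq_conj, mul_sub, sub_eq_add_neg, AddChar.map_add_eq_mul]
    ring
  have h := sum_congr rfl fun s (_ : s ∈ (univ : Finset F)) => hs s
  rw [← sum_mul, AddChar.sum_mulShift _ hχ, if_neg (sub_ne_zero.2 hjk.symm), sum_const] at h
  simpa using h

lemma exists_character {χ : AddChar F ℂ} (hχ : χ.IsPrimitive) {ψ : SL₂ F → ℂ} (h0 : ψ ≠ 0)
    (hm : ∑ x, ψ x = 0) :
    ∃ k ≠ (0 : F), ∃ g x : SL₂ F, ∑ s, χ (s * -k) * ψ (x * upper s * g) ≠ 0 := by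
  by_contra! hcon
  have hinv : ∀ g x : SL₂ F, ∀ t, ψ (x * upper t * g) = ψ (x * g) := by
    intro g x
    have hF : ∀ t, (Fintype.card F : ℂ) * ψ (x * upper t * g) = ∑ s, ψ (x * upper s * g) := by
      intro t
      have h1 : ∑ k : F, χ (t * k) * ∑ s, χ (s * -k) * ψ (x * upper s * g) =
          ∑ s, ψ (x * upper s * g) := by
        rw [sum_eq_single 0]
        · simp
        · intro k _ hk
          rw [hcon k hk g x, mul_zero]
        · simp
      have h2 : ∀ s : F, ∑ k : F, χ (t * k) * (χ (s * -k) * ψ (x * upper s * g)) =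
          (if t - s = 0 then (Fintype.card F : ℂ) else 0) * ψ (x * upper s * g) := by
        intro s
        have h3 := AddChar.sum_mulShift (t - s) hχ
        split_ifs with hs
        · rw [if_pos hs] at h3
          rw [← h3, sum_mul]
          refine sum_congr rfl fun k _ => ?_
          rw [← mul_assoc, ← AddChar.map_add_eq_mul]
          congr 2
          ring
        · rw [if_neg hs] at h3
          rw [← Nat.cast_zero, ← h3, sum_mul]
          refine sum_congr rfl fun k _ => ?_
          rw [← mul_assoc, ← AddChar.map_add_eq_mul]
          congr 2
          ring
      rw [← h1]
      simp only [mul_sum]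
      rw [sum_comm, sum_congr rfl fun s _ => h2 s, sum_eq_single t]
      · simp
      · intro s _ hs
        rw [if_neg (sub_ne_zero.2 hs.symm), zero_mul]
      · simp
    intro t
    have hcard : (Fintype.card F : ℂ) ≠ 0 := by
      exact_mod_cast Fintype.card_ne_zero
    refine mul_left_cancel₀ hcard ?_
    rw [hF t, ← hF 0, upper_zero, mul_one]
  let S : Subgroup (SL₂ F) :=
    { carrier := {h | ∀ x, ψ (x * h) = ψ x}
      mul_mem' := fun {a b} ha hb x => by rw [← mul_assoc, hb, ha]
      one_mem' := fun x => by rw [mul_one]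
      inv_mem' := fun {a} ha x => by rw [← ha (x * a⁻¹), inv_mul_cancel_right] }
  have hS : S = ⊤ := by
    refine eq_top_of_upper_mem fun g s x => ?_
    have h := hinv g (x * g⁻¹) s
    rw [inv_mul_cancel_right] at h
    rw [← h]
    simp only [mul_assoc]
  have hconst : ∀ x, ψ x = ψ 1 := by
    intro x
    have hx : x ∈ S := hS ▸ Subgroup.mem_top x
    have h := hx 1
    rwa [one_mul] at h
  apply h0
  funext x
  rw [sum_congr rfl fun x _ => hconst x, sum_const, nsmul_eq_mul] at hm
  rcases mul_eq_zero.1 hm with h | h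
  · have : (univ : Finset (SL₂ F)).card = 0 := by exact_mod_cast h
    simp at this
  · rw [hconst x, h]
    rfl

/-- **Quasirandomness** of `SL₂(F)`: every eigenvalue of a convolution operator on functions of mean
zero has high multiplicity, and is therefore controlled by the `ℓ²` norm of the weight. -/
theorem card_sub_one_mul_sq_le {χ : AddChar F ℂ} (hχ : χ.IsPrimitive) {ψ : SL₂ F → ℂ} (h0 : ψ ≠ 0)
    (hm : ∑ x, ψ x = 0) {f : SL₂ F → ℝ} {c : ℝ} (hψ : ∀ x, convR f ψ x = c * ψ x) :
    ((Fintype.card F : ℝ) - 1) / 2 * c ^ 2 ≤ Fintype.card (SL₂ F) * ∑ x, f x ^ 2 := by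
  obtain ⟨k, hk, g, x₀, hx₀⟩ := exists_character hχ h0 hm
  let φ : Fˣ → SL₂ F → ℂ := fun a x => ∑ s, χ (s * -k) * ψ (x * (diag a * upper s * g))
  have hφ0 : ∀ a, φ a ≠ 0 := by
    intro a h
    apply hx₀
    have h1 := congrFun h (x₀ * (diag a)⁻¹)
    rw [← Pi.zero_apply (M := fun _ => ℂ) (x₀ * (diag a)⁻¹), ← h1]
    simp only [φ, ← mul_assoc, inv_mul_cancel_right]
  have hφ : ∀ a x t, φ a (x * upper t) = χ (t * (k / a ^ 2)) * φ a x := by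
    intro a x t
    simp only [φ]
    rw [mul_sum, ← Equiv.sum_comp (Equiv.subRight (t / (a : F) ^ 2))]
    refine sum_congr rfl fun s _ => ?_
    rw [Equiv.subRight_apply, ← mul_assoc (χ _), ← AddChar.map_add_eq_mul]
    congr 2
    · ring
    · rw [mul_assoc, mul_assoc, mul_assoc, ← mul_assoc (upper t), upper_mul_diag, mul_assoc,
        ← mul_assoc (upper (t / (a : F) ^ 2)), upper_mul, add_sub_cancel]
  let I : Finset F := univ.image fun a : Fˣ => k / (a : F) ^ 2
  have hI : Fintype.card F - 1 ≤ 2 * #I := by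
    rw [← Fintype.card_units, ← card_univ]
    refine card_le_mul_card_image _ 2 fun t ht => ?_
    obtain ⟨b, -, hb⟩ := mem_image.1 ht
    refine (card_le_card (t := {b, -b}) fun a ha => ?_).trans card_le_two
    have h1 : k / (a : F) ^ 2 = k / (b : F) ^ 2 := by rw [hb, (mem_filter.1 ha).2]
    rw [div_eq_div_iff (pow_ne_zero 2 a.ne_zero) (pow_ne_zero 2 b.ne_zero)] at h1
    rw [mem_insert, mem_singleton, Units.ext_iff, Units.ext_iff, Units.val_neg]
    exact sq_eq_sq_iff_eq_or_eq_neg.1 (mul_left_cancel₀ hk h1).symm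
  have hchoose : ∀ t : I, ∃ a : Fˣ, k / (a : F) ^ 2 = t := fun t => by
    obtain ⟨b, -, hb⟩ := mem_image.1 t.2
    exact ⟨b, hb⟩
  choose a ha using hchoose
  have h := card_mul_sq_le f c (fun t : I => φ (a t)) (fun t => hφ0 _)
    (fun t x => convR_sum_translates f hψ _ _ x) fun i j hij =>
      sum_conj_mul_eq_zero hχ (Subtype.coe_injective.ne hij)
        (fun x s => by rw [hφ, ha]) fun x s => by rw [hφ, ha]
  refine le_trans (mul_le_mul_of_nonneg_right ?_ (sq_nonneg c)) h
  rw [Fintype.card_coe]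
  have h1 : ((Fintype.card F - 1 : ℕ) : ℝ) ≤ 2 * #I := by exact_mod_cast hI
  rw [Nat.cast_sub Fintype.card_pos, Nat.cast_one] at h1
  linarith

end Unipotent

end L2Flattening

namespace L2Flattening

section Flattening

open scoped Pointwise in
/-- A weight which is not flattened by convolution with itself, and which does not charge cosets
of proper subgroups, yields an approximate subgroup which generates the whole group. -/
lemma exists_approximate_subgroup {G : Type*} [Group G] [Fintype G] {f : G → ℝ}
    (hf0 : ∀ x, 0 ≤ f x) (hf1 : ∑ x, f x = 1) (hsymm : ∀ x, f x⁻¹ = f x) {M K c : ℝ}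
    (hM : ∀ x, f x ≤ M) (hK : 2 ^ 14 ≤ K) (hE : M / K ≤ ∑ x, conv f f x ^ 2)
    (hc : ∀ H : Subgroup G, H ≠ ⊤ → ∀ b, ∑ x with b⁻¹ * x ∈ H, f x ≤ c) (hcK : K ^ 22 * c < 1) :
    ∃ P : SymmetricPowers G, Subgroup.closure (P.sets 1 : Set G) = ⊤ ∧
      (#(P.sets 25) : ℝ) ≤ K ^ 286 * #(P.sets 1) ∧ 1 ≤ M * K ^ 7 * #(P.sets 1) ∧
      #(P.sets 1) * M ≤ K ^ 19 := by
  have hK1 : 1 ≤ K := by linarith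
  have hK0 : 0 < K := by linarith
  have hM0 : 0 < M := by
    by_contra h
    have : ∑ x, f x ≤ 0 := sum_nonpos fun x _ => (hM x).trans (not_lt.1 h)
    linarith
  obtain ⟨A, hAf, hA⟩ := exists_card_inv_mul_le hf0 hf1 hsymm hM hK1 hE
  have hAM : 1 / (4 * K) ≤ #A * M := by
    refine hAf.trans ((sum_le_sum fun x _ => hM x).trans ?_)
    rw [sum_const, nsmul_eq_mul]
  have hA1 : 1 ≤ 4 * K * (#A * M) := by
    rwa [div_le_iff₀' (by linarith)] at hAM
  have hA0 : (0 : ℝ) < #A := by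
    by_contra h
    have h' : (#A : ℝ) = 0 := le_antisymm (not_lt.1 h) (Nat.cast_nonneg _)
    rw [h'] at hA1
    linarith
  have hAne : A.Nonempty := card_pos.1 (by exact_mod_cast hA0)
  set L : ℝ := K ^ 5 with hL
  have hL1 : 1 ≤ L := one_le_pow₀ hK1
  have hL0 : 0 < L := by linarith
  have hAL : (#(A⁻¹ * A) : ℝ) ≤ L * #A := by
    refine hA.trans ?_
    rw [div_le_iff₀ hM0]
    calc 4096 * K ^ 3 ≤ 4096 * K ^ 3 * (4 * K * (#A * M)) :=
          le_mul_of_one_le_right (by positivity) hA1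
      _ = (2 ^ 14 * K ^ 4) * (#A * M) := by ring
      _ ≤ (K * K ^ 4) * (#A * M) := by gcongr
      _ = L * #A * M := by rw [hL]; ring
  obtain ⟨H, h1, hinv, hHA, hH⟩ := exists_symmetric_popular hAne hL1 hAL
  have hpow := card_pow_le_of_popular hAne hL1 hAL hH
  have hAH : #A ≤ 2 * L * #H := by
    rwa [div_le_iff₀' (by linarith)] at hHA
  have hH0 : (0 : ℝ) < #H := by exact_mod_cast card_pos.2 ⟨1, h1⟩
  have hone : (#(A⁻¹ * H * A) : ℝ) ≤ 2 * L ^ 3 * #A := by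
    have h := hpow 1
    rw [pow_one, pow_one] at h
    linarith
  refine ⟨SymmetricPowers.ofFinset H hinv h1, ?_, ?_, ?_, ?_⟩
  · change Subgroup.closure ((H ^ 1 : Finset G) : Set G) = ⊤
    rw [pow_one]
    by_contra hne
    have hsum : ∑ a ∈ A⁻¹, f a = ∑ a ∈ A, f a := by
      rw [← image_inv_eq_inv, sum_image (fun x _ y _ h => inv_injective h)]
      exact sum_congr rfl fun x _ => hsymm x
    have h := card_mul_sum_le_of_coset hf0 (A := A⁻¹)
      (fun h hh => Subgroup.subset_closure (mem_coe.2 hh)) (hc _ hne)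
    rw [hsum] at h
    have hc0 : 0 ≤ c := (sum_nonneg fun x _ => hf0 x).trans (hc _ hne 1)
    have h3 : (#(A⁻¹ * H) : ℝ) ≤ 4 * L ^ 4 * #H := by
      have h4 : (#(A⁻¹ * H) : ℝ) ≤ #(A⁻¹ * H * A) := by
        exact_mod_cast card_le_card_mul_right hAne
      calc (#(A⁻¹ * H) : ℝ) ≤ 2 * L ^ 3 * #A := h4.trans hone
        _ ≤ 2 * L ^ 3 * (2 * L * #H) := by gcongr
        _ = 4 * L ^ 4 * #H := by ring
    have h5 : #H * (1 / (4 * K)) ≤ #H * (4 * L ^ 4 * c) :=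
      calc #H * (1 / (4 * K)) ≤ #H * ∑ a ∈ A, f a := by gcongr
        _ ≤ #(A⁻¹ * H) * c := h
        _ ≤ 4 * L ^ 4 * #H * c := by gcongr
        _ = #H * (4 * L ^ 4 * c) := by ring
    have h6 := le_of_mul_le_mul_left h5 hH0
    rw [div_le_iff₀' (by linarith)] at h6
    have h7 : 4 * K * (4 * L ^ 4 * c) ≤ K ^ 22 * c :=
      calc 4 * K * (4 * L ^ 4 * c) = 16 * (K ^ 21 * c) := by rw [hL]; ring
        _ ≤ K * (K ^ 21 * c) := by gcongr; linarith
        _ = K ^ 22 * c := by ring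
    linarith
  · change (#(H ^ 25 : Finset G) : ℝ) ≤ K ^ 286 * #(H ^ 1 : Finset G)
    rw [pow_one]
    have h2 : (#(H ^ 25) : ℝ) ≤ #(A⁻¹ * H ^ 25 * A) := by
      have h3 : #(H ^ 25) ≤ #(A⁻¹ * H ^ 25) := card_le_card_mul_left hAne.inv
      exact_mod_cast h3.trans (card_le_card_mul_right hAne)
    have h4 : 2 * L ^ 2 ≤ K ^ 11 :=
      calc 2 * L ^ 2 ≤ K * L ^ 2 := by gcongr; linarith
        _ = K ^ 11 := by rw [hL]; ring
    calc (#(H ^ 25) : ℝ) ≤ (2 * L ^ 2) ^ 25 * L * #A := h2.trans (hpow 25)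
      _ ≤ (2 * L ^ 2) ^ 25 * L * (2 * L * #H) := by gcongr
      _ = (2 * L ^ 2) ^ 26 * #H := by ring
      _ ≤ (K ^ 11) ^ 26 * #H := by gcongr
      _ = K ^ 286 * #H := by rw [← pow_mul]
  · change 1 ≤ M * K ^ 7 * #(H ^ 1 : Finset G)
    rw [pow_one]
    calc 1 ≤ 4 * K * (#A * M) := hA1
      _ ≤ 4 * K * (2 * L * #H * M) := by gcongr
      _ = 8 * (M * K ^ 6 * #H) := by rw [hL]; ring
      _ ≤ K * (M * K ^ 6 * #H) := by gcongr; linarith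
      _ = M * K ^ 7 * #H := by ring
  · change #(H ^ 1 : Finset G) * M ≤ K ^ 19
    rw [pow_one]
    have h2 : (#H : ℝ) ≤ #(A⁻¹ * H * A) := by
      have h3 : #H ≤ #(A⁻¹ * H) := card_le_card_mul_left hAne.inv
      exact_mod_cast h3.trans (card_le_card_mul_right hAne)
    have h4 : (#A : ℝ) ≤ #(A⁻¹ * A) := by exact_mod_cast card_le_card_mul_left hAne.inv
    calc #H * M ≤ 2 * L ^ 3 * (4096 * K ^ 3 / M) * M := by
          gcongr
          refine h2.trans (hone.trans ?_)
          gcongr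
          exact h4.trans hA
      _ = 2 ^ 13 * K ^ 18 := by rw [hL]; field_simp; ring
      _ ≤ K * K ^ 18 := by gcongr; linarith
      _ = K ^ 19 := by ring

/-- **Flattening**: a weight on `SL₂(F)` which does not charge cosets of proper subgroups is either
flattened by convolution with itself or nearly uniform. -/
lemma card_pow_three_mul_le {F : Type*} [Field F] [Fintype F] [Fintype (SL₂ F)] (h2 : (2 : F) ≠ 0)
    (h3 : (3 : F) ≠ 0) {f : SL₂ F → ℝ}
    (hf0 : ∀ x, 0 ≤ f x) (hf1 : ∑ x, f x = 1) (hsymm : ∀ x, f x⁻¹ = f x) {M K c : ℝ}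
    (hM : ∀ x, f x ≤ M) (hK : 2 ^ 14 ≤ K) (hE : M / K ≤ ∑ x, conv f f x ^ 2)
    (hc : ∀ H : Subgroup (SL₂ F), H ≠ ⊤ → ∀ b, ∑ x with b⁻¹ * x ∈ H, f x ≤ c)
    (hcK : K ^ 22 * c < 1) (hMK : K ^ 582 * M ≤ 1) :
    (Fintype.card F : ℝ) ^ 3 * M ≤ K ^ 735 := by
  obtain ⟨P, hgen, h25, hlow, hup⟩ := exists_approximate_subgroup hf0 hf1 hsymm hM hK hE hc hcK
  have hK0 : 0 < K := by linarith
  have hM0 : 0 < M := by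
    by_contra h
    have : ∑ x, f x ≤ 0 := sum_nonpos fun x _ => (hM x).trans (not_lt.1 h)
    linarith
  set h : ℝ := (#(P.sets 1) : ℝ) with hh
  have hKsq : 2 ^ 21 ≤ K ^ 2 := by nlinarith
  have hbig : 1728 * 9 ^ 3 * (K ^ 286) ^ 2 < h := by
    have h4 : K ^ 575 ≤ h := by
      have h5 : K ^ 582 * M * h ≤ 1 * h := by gcongr
      calc K ^ 575 = K ^ 575 * 1 := (mul_one _).symm
        _ ≤ K ^ 575 * (M * K ^ 7 * h) := by gcongr
        _ = K ^ 582 * M * h := by ring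
        _ ≤ h := by linarith
    refine lt_of_lt_of_le ?_ h4
    calc 1728 * 9 ^ 3 * (K ^ 286) ^ 2 < K ^ 3 * (K ^ 286) ^ 2 := by
          gcongr
          nlinarith
      _ = K ^ 575 := by ring
  have h6 := card_pow_six_le h2 h3 P hgen h25 hbig
  have h7 : ((Fintype.card F : ℝ) ^ 3 * M) ^ 2 ≤ (K ^ 735) ^ 2 :=
    calc ((Fintype.card F : ℝ) ^ 3 * M) ^ 2 = (Fintype.card F : ℝ) ^ 6 * M ^ 2 := by ring
      _ ≤ 1728000 * (K ^ 286) ^ 5 * h ^ 2 * M ^ 2 := by gcongr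
      _ = 1728000 * (K ^ 1430 * (h * M) ^ 2) := by ring
      _ ≤ K ^ 2 * (K ^ 1430 * (K ^ 19) ^ 2) :=
          mul_le_mul (by linarith) (mul_le_mul_of_nonneg_left
            (pow_le_pow_left₀ (mul_nonneg (Nat.cast_nonneg _) hM0.le) hup 2) (pow_nonneg hK0.le _))
            (mul_nonneg (pow_nonneg hK0.le _) (sq_nonneg _)) (sq_nonneg _)
      _ = (K ^ 735) ^ 2 := by ring
  exact le_of_sq_le_sq h7 (by positivity)

end Flattening

end L2Flattening

namespace L2Flattening

section Iteration

variable {G : Type*} [Group G] [Fintype G]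

/-- The convolution power of `f` of exponent `2 ^ n`. -/
noncomputable def convPow (f : G → ℝ) : ℕ → G → ℝ
  | 0 => f
  | n + 1 => conv (convPow f n) (convPow f n)

variable {f : G → ℝ}

lemma convPow_nonneg (hf0 : ∀ x, 0 ≤ f x) (n : ℕ) (x : G) : 0 ≤ convPow f n x := by
  induction n generalizing x with
  | zero => exact hf0 x
  | succ n ih => exact conv_nonneg ih ih x

lemma sum_convPow (hf1 : ∑ x, f x = 1) (n : ℕ) : ∑ x, convPow f n x = 1 := by
  induction n with
  | zero => exact hf1
  | succ n ih => rw [convPow, sum_conv, ih, one_mul]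

lemma convPow_inv (hsymm : ∀ x, f x⁻¹ = f x) (n : ℕ) (x : G) :
    convPow f n x⁻¹ = convPow f n x := by
  induction n generalizing x with
  | zero => exact hsymm x
  | succ n ih => exact conv_self_inv ih x

lemma convPow_succ_one (hsymm : ∀ x, f x⁻¹ = f x) (n : ℕ) :
    convPow f (n + 1) 1 = ∑ x, convPow f n x ^ 2 :=
  conv_self_one (convPow_inv hsymm n)

lemma convPow_le (hsymm : ∀ x, f x⁻¹ = f x) (hmax : ∀ x, f x ≤ f 1) (n : ℕ) (x : G) :
    convPow f n x ≤ convPow f n 1 := by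
  cases n with
  | zero => exact hmax x
  | succ n => exact conv_self_le (convPow_inv hsymm n) x

lemma sum_coset_convPow_le (hf0 : ∀ x, 0 ≤ f x) (hf1 : ∑ x, f x = 1) {H : Subgroup G} {c : ℝ}
    (hc : ∀ a, ∑ x with a⁻¹ * x ∈ H, f x ≤ c) (n : ℕ) (a : G) :
    ∑ x with a⁻¹ * x ∈ H, convPow f n x ≤ c := by
  induction n generalizing a with
  | zero => exact hc a
  | succ n ih => exact conv_sum_coset_le (convPow_nonneg hf0 n) (sum_convPow hf1 n) ih a

lemma convPow_one_antitone (hf0 : ∀ x, 0 ≤ f x) (hf1 : ∑ x, f x = 1)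
    (hsymm : ∀ x, f x⁻¹ = f x) (hmax : ∀ x, f x ≤ f 1) : Antitone fun n => convPow f n 1 := by
  refine antitone_nat_of_succ_le fun n => ?_
  rw [convPow_succ_one hsymm]
  calc ∑ x, convPow f n x ^ 2 ≤ ∑ x, convPow f n x * convPow f n 1 :=
        sum_le_sum fun x _ => by
          rw [sq]
          exact mul_le_mul_of_nonneg_left (convPow_le hsymm hmax n x) (convPow_nonneg hf0 n x)
    _ = convPow f n 1 := by rw [← sum_mul, sum_convPow hf1, one_mul]

lemma convR_convPow {c : ℝ} {ψ : G → ℂ} (hψ : ∀ x, convR f ψ x = c * ψ x) (n : ℕ) (x : G) :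
    convR (convPow f n) ψ x = ((c ^ 2 ^ n : ℝ) : ℂ) * ψ x := by
  induction n generalizing x with
  | zero => simpa [convPow] using hψ x
  | succ n ih =>
    rw [convPow, ← convR_convR, funext ih]
    have h : convR (convPow f n) (fun y => ((c ^ 2 ^ n : ℝ) : ℂ) * ψ y) x =
        ((c ^ 2 ^ n : ℝ) : ℂ) * convR (convPow f n) ψ x := by
      unfold convR
      rw [mul_sum]
      exact sum_congr rfl fun y _ => mul_left_comm _ _ _
    rw [h, ih, ← mul_assoc, ← Complex.ofReal_mul, ← pow_add, pow_succ, mul_two]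

/-- Some convolution power in a bounded range is not flattened by two further convolutions. -/
lemma exists_convPow_one_div_le (hf1 : ∑ x, f x = 1) (hsymm : ∀ x, f x⁻¹ = f x) (hmax : ∀ x, f x ≤ f 1) (hle : f 1 ≤ 1) {K : ℝ} (hK : 0 < K) {J : ℕ}
    (hJ : Fintype.card G < K ^ J) :
    ∃ j < J, convPow f (2 * j) 1 / K ≤ convPow f (2 * j + 2) 1 := by
  by_contra! hcon
  have h : ∀ j ≤ J, convPow f (2 * j) 1 * K ^ j ≤ 1 := by
    intro j
    induction j with
    | zero => intro _; simpa [convPow] using hle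
    | succ j ih =>
      intro hj
      refine le_trans ?_ (ih (by omega))
      have h1 := (hcon j (by omega)).le
      rw [le_div_iff₀ hK] at h1
      calc convPow f (2 * (j + 1)) 1 * K ^ (j + 1)
          = convPow f (2 * j + 2) 1 * K * K ^ j := by rw [pow_succ, mul_add]; ring
        _ ≤ convPow f (2 * j) 1 * K ^ j := mul_le_mul_of_nonneg_right h1 (pow_nonneg hK.le _)
  have h2 : 1 ≤ Fintype.card G * convPow f (2 * J) 1 :=
    calc 1 = ∑ x, convPow f (2 * J) x := (sum_convPow hf1 _).symm
      _ ≤ ∑ _x : G, convPow f (2 * J) 1 := sum_le_sum fun x _ => convPow_le hsymm hmax _ x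
      _ = Fintype.card G * convPow f (2 * J) 1 := by simp
  have h3 : 0 < convPow f (2 * J) 1 := by
    by_contra hneg
    have : Fintype.card G * convPow f (2 * J) 1 ≤ 0 :=
      mul_nonpos_of_nonneg_of_nonpos (Nat.cast_nonneg _) (not_lt.1 hneg)
    linarith
  have h4 := h J le_rfl
  have h5 : Fintype.card G * convPow f (2 * J) 1 < K ^ J * convPow f (2 * J) 1 :=
    mul_lt_mul_of_pos_right hJ h3
  linarith

/-- The eigenvalues of convolution by a weight which does not charge cosets of proper subgroups of
`SL₂(F)`, on functions of mean zero, are bounded away from `1`. -/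
theorem exists_eigenvalue_pow_le {F : Type*} [Field F] [Fintype F] [Fintype (SL₂ F)]
    (h2 : (2 : F) ≠ 0) (h3 : (3 : F) ≠ 0) {χ : AddChar F ℂ} (hχ : χ.IsPrimitive)
    {f : SL₂ F → ℝ} (hf0 : ∀ x, 0 ≤ f x) (hf1 : ∑ x, f x = 1)
    (hsymm : ∀ x, f x⁻¹ = f x) (hmax : ∀ x, f x ≤ f 1) {K c : ℝ} (hfc : f 1 ≤ c)
    (hc : ∀ H : Subgroup (SL₂ F), H ≠ ⊤ → ∀ b, ∑ x with b⁻¹ * x ∈ H, f x ≤ c)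
    (hK : 2 ^ 14 ≤ K) (hKF : K ^ 737 ≤ Fintype.card F) (hKc : K ^ 582 * c ≤ 1) {J : ℕ}
    (hJ : (Fintype.card F : ℝ) ^ 4 ≤ K ^ J) {r : ℝ} {ψ : SL₂ F → ℂ} (hψ0 : ψ ≠ 0)
    (hm : ∑ x, ψ x = 0) (hψ : ∀ x, convR f ψ x = r * ψ x) :
    ∃ n < 2 * J, r ^ 2 ^ (n + 1) ≤ 1 / K := by
  have hK0 : 0 < K := by linarith
  have hK1 : 1 ≤ K := by linarith
  set q : ℝ := (Fintype.card F : ℝ) with hq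
  have hc0 : 0 ≤ c := (hf0 1).trans hfc
  have hKq : K ≤ q := (le_self_pow₀ hK1 (by norm_num)).trans hKF
  have hG : (Fintype.card (SL₂ F) : ℝ) ≤ 2 * q ^ 3 := by
    rw [hq]
    exact_mod_cast card_le_two_mul_card_pow (F := F)
  have hGJ : (Fintype.card (SL₂ F) : ℝ) < K ^ J := by
    refine lt_of_le_of_lt hG (lt_of_lt_of_le ?_ hJ)
    rw [pow_succ' q 3]
    exact mul_lt_mul_of_pos_right (by linarith) (pow_pos (by linarith) 3)
  have hc1 : c ≤ 1 := (le_mul_of_one_le_left hc0 (one_le_pow₀ hK1)).trans hKc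
  have hcK : K ^ 22 * c < 1 := by
    rcases hc0.eq_or_lt with h | h
    · rw [← h, mul_zero]
      exact one_pos
    · exact lt_of_lt_of_le (mul_lt_mul_of_pos_right
        (pow_lt_pow_right₀ (by linarith) (by norm_num)) h) hKc
  obtain ⟨j, hj, hE⟩ :=
    exists_convPow_one_div_le hf1 hsymm hmax (hfc.trans hc1) hK0 hGJ
  refine ⟨2 * j, by omega, ?_⟩
  set M := convPow f (2 * j) 1 with hM
  rw [convPow_succ_one hsymm] at hE
  have hMc : M ≤ c := (convPow_one_antitone hf0 hf1 hsymm hmax (Nat.zero_le (2 * j))).trans hfc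
  have hflat := card_pow_three_mul_le h2 h3 (convPow_nonneg hf0 (2 * j)) (sum_convPow hf1 _)
    (convPow_inv hsymm _) (convPow_le hsymm hmax _) hK hE
    (fun H hH => sum_coset_convPow_le hf0 hf1 (hc H hH) _) hcK
    ((mul_le_mul_of_nonneg_left hMc (pow_nonneg hK0.le _)).trans hKc)
  have hmix := card_sub_one_mul_sq_le hχ hψ0 hm (convR_convPow hψ (2 * j))
  rw [← convPow_succ_one hsymm, ← pow_mul, ← pow_succ, ← hq] at hmix
  have hanti : convPow f (2 * j + 1) 1 ≤ M :=
    convPow_one_antitone hf0 hf1 hsymm hmax (Nat.le_succ (2 * j))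
  set R : ℝ := r ^ 2 ^ (2 * j + 1) with hR
  have hR0 : 0 ≤ R := by
    rw [hR, pow_succ, pow_mul]
    exact sq_nonneg _
  have h4 : Fintype.card (SL₂ F) * convPow f (2 * j + 1) 1 ≤ 2 * K ^ 735 :=
    calc Fintype.card (SL₂ F) * convPow f (2 * j + 1) 1 ≤ 2 * q ^ 3 * M :=
          mul_le_mul hG hanti (convPow_nonneg hf0 _ _) (by positivity)
      _ = 2 * (q ^ 3 * M) := by ring
      _ ≤ 2 * K ^ 735 := by linarith
  have h5 : q / 4 * R ≤ (q - 1) / 2 * R := mul_le_mul_of_nonneg_right (by linarith) hR0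
  have h6 : q * R ≤ 8 * K ^ 735 := by linarith
  have h7 : K ^ 737 * R ≤ K * K ^ 735 :=
    (mul_le_mul_of_nonneg_right hKF hR0).trans
      (h6.trans (mul_le_mul_of_nonneg_right (by linarith) (pow_nonneg hK0.le _)))
  rw [le_div_iff₀' hK0]
  refine le_of_mul_le_mul_left ?_ (pow_pos hK0 736)
  calc K ^ 736 * (K * R) = K ^ 737 * R := by rw [← mul_assoc, ← pow_succ]
    _ ≤ K * K ^ 735 := h7
    _ = K ^ 736 * 1 := by rw [← pow_succ', mul_one]

end Iteration

end L2Flattening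

namespace L2Flattening

section SpectralGap

/-- Convolution by `μ` contracts functions of mean zero if the top eigenvalue of `μ̃ ∗ μ` is
small. -/
lemma l2Norm_convR_le {G : Type*} [Group G] [Fintype G] {μ : G → ℝ} {ε : ℝ} (hε : 0 ≤ ε)
    (h : ∀ (r : ℝ) (ψ : G → ℂ), ψ ≠ 0 → ∑ x, ψ x = 0 →
      (∀ x, convR (conv (fun y => μ y⁻¹) μ) ψ x = r * ψ x) → r ≤ ε ^ 2)
    {φ : G → ℂ} (hφ : ∑ x, φ x = 0) :
    l2Norm (convR μ φ) ≤ ε * l2Norm φ := by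
  by_cases hφ0 : φ = 0
  · simp [hφ0, l2Norm, convR]
  obtain ⟨r, ψ, hψ0, hm, hψ, hmax⟩ := exists_eigenvector (conv_inv_self_inv μ) hφ0 hφ
  have hr := h r ψ hψ0 hm hψ
  unfold l2Norm
  rw [← Real.sqrt_sq hε, ← Real.sqrt_mul (sq_nonneg ε), sum_norm_convR_sq]
  refine Real.sqrt_le_sqrt ((hmax φ hφ).trans ?_)
  exact mul_le_mul_of_nonneg_right hr (sum_nonneg fun x _ => sq_nonneg _)

lemma le_rpow_of_pow_le {r K : ℝ} (hK : 1 ≤ K) {n N : ℕ} (hn : 0 < n) (hnN : n ≤ N)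
    (h : r ^ n ≤ 1 / K) : r ≤ K ^ (-(1 / N : ℝ)) := by
  have hK0 : 0 < K := by linarith
  have hN : (N : ℝ) ≠ 0 := by
    have : N ≠ 0 := by omega
    exact_mod_cast this
  refine le_of_pow_le_pow_left₀ hn.ne' (Real.rpow_nonneg hK0.le _) (h.trans ?_)
  have h1 : (K ^ (-(1 / N : ℝ))) ^ N = 1 / K := by
    rw [← Real.rpow_natCast, ← Real.rpow_mul hK0.le, neg_mul, one_div_mul_cancel hN,
      Real.rpow_neg_one, one_div]
  rw [← h1]
  refine pow_le_pow_of_le_one (Real.rpow_nonneg hK0.le _) ?_ hnN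
  exact Real.rpow_le_one_of_one_le_of_nonpos hK (by simp)

/-- The spectral gap for convolution by a probability measure on `SL₂(F)` which does not charge
cosets of proper subgroups. -/
theorem l2Norm_convR_le_of_coset {F : Type*} [Field F] [Fintype F] [Fintype (SL₂ F)]
    (h2 : (2 : F) ≠ 0) (h3 : (3 : F) ≠ 0) {χ : AddChar F ℂ} (hχ : χ.IsPrimitive)
    {μ : SL₂ F → ℝ} (hμ0 : ∀ x, 0 ≤ μ x) (hμ1 : ∑ x, μ x = 1) {K c : ℝ} (hμc : ∀ x, μ x ≤ c)
    (hc : ∀ H : Subgroup (SL₂ F), H ≠ ⊤ → ∀ b, ∑ x with b⁻¹ * x ∈ H, μ x ≤ c)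
    (hK : 2 ^ 14 ≤ K) (hKF : K ^ 737 ≤ Fintype.card F) (hKc : K ^ 582 * c ≤ 1) {J : ℕ}
    (hJ : (Fintype.card F : ℝ) ^ 4 ≤ K ^ J) {φ : SL₂ F → ℂ} (hφ : ∑ x, φ x = 0) :
    l2Norm (convR μ φ) ≤ K ^ (-(1 / 2 ^ (2 * J + 1) : ℝ)) * l2Norm φ := by
  have hK1 : 1 ≤ K := by linarith
  have hK0 : 0 < K := by linarith
  have hinv : ∑ x, μ x⁻¹ = 1 := (Equiv.sum_comp (Equiv.inv _) μ).trans hμ1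
  refine l2Norm_convR_le (Real.rpow_nonneg hK0.le _) (fun r ψ hψ0 hm hψ => ?_) hφ
  have hone : conv (fun y => μ y⁻¹) μ 1 ≤ c := by
    rw [conv_inv_self_one]
    calc ∑ x, μ x ^ 2 ≤ ∑ x, μ x * c := sum_le_sum fun x _ => by
          rw [sq]
          exact mul_le_mul_of_nonneg_left (hμc x) (hμ0 x)
      _ = c := by rw [← sum_mul, hμ1, one_mul]
  obtain ⟨n, hn, hrn⟩ := exists_eigenvalue_pow_le h2 h3 hχ
    (conv_nonneg (fun x => hμ0 x⁻¹) hμ0) (by rw [sum_conv, hinv, hμ1, one_mul])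
    (conv_inv_self_inv μ) (conv_inv_self_le μ) hone
    (fun H hH => conv_sum_coset_le (fun x => hμ0 x⁻¹) hinv (hc H hH)) hK hKF hKc hJ hψ0 hm hψ
  refine (le_rpow_of_pow_le hK1 (by positivity)
    (Nat.pow_le_pow_right two_pos (Nat.succ_le_of_lt hn)) hrn).trans (le_of_eq ?_)
  rw [← Real.rpow_natCast, ← Real.rpow_mul hK0.le]
  congr 1
  push_cast
  rw [pow_succ]
  field_simp

end SpectralGap

end L2Flattening

/-- Lemma (`L²`-flattening for probability measures on `SL₂(𝔽_p)`).  Given `τ > 0` there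
are `τ′ > 0` and `p₀` such that for every prime `p ≥ p₀` and `G = SL₂(ℤ/pℤ)`: if a
probability measure `μ` on `G` satisfies `‖μ‖_∞ < p^{−τ}` and `μ(aG₁) < p^{−τ}` for every
coset of every proper subgroup `G₁ < G`, then `‖μ ∗ φ‖₂ ≤ p^{−τ′} ‖φ‖₂` for every
mean-zero `φ : G → ℂ`. -/
theorem l2_flattening_probability_measure
    (τ : ℝ) (hτ : 0 < τ) :
    ∃ τ' > (0 : ℝ), ∃ p₀ : ℕ,
      ∀ (p : ℕ) [NeZero p], p.Prime → p₀ ≤ p →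
      ∀ μ : Matrix.SpecialLinearGroup (Fin 2) (ZMod p) → ℝ,
        (∀ g, 0 ≤ μ g) →
        (∑ g : Matrix.SpecialLinearGroup (Fin 2) (ZMod p), μ g) = 1 →
        (∀ x : Matrix.SpecialLinearGroup (Fin 2) (ZMod p), μ x < (p : ℝ) ^ (-τ)) →
        (∀ G₁ : Subgroup (Matrix.SpecialLinearGroup (Fin 2) (ZMod p)), G₁ ≠ ⊤ →
          ∀ a : Matrix.SpecialLinearGroup (Fin 2) (ZMod p),
            ∑ x ∈ Finset.univ.filter (fun x => a⁻¹ * x ∈ G₁), μ x < (p : ℝ) ^ (-τ)) →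
        ∀ φ : Matrix.SpecialLinearGroup (Fin 2) (ZMod p) → ℂ,
          (∑ x : Matrix.SpecialLinearGroup (Fin 2) (ZMod p), φ x) = 0 →
          l2Norm (convR μ φ) ≤ (p : ℝ) ^ (-τ') * l2Norm φ := by
  set δ : ℝ := min τ 1 / 737 with hδ
  have hδ0 : 0 < δ := div_pos (lt_min hτ one_pos) (by norm_num)
  have hδτ : 582 * δ ≤ τ := by
    have h : min τ 1 ≤ τ := min_le_left _ _
    have h' : 737 * δ = min τ 1 := by rw [hδ]; ring
    linarith
  have hδ1 : 737 * δ ≤ 1 := by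
    have h : min τ 1 ≤ 1 := min_le_right _ _
    have h' : 737 * δ = min τ 1 := by rw [hδ]; ring
    linarith
  set J : ℕ := ⌈4 / δ⌉₊ with hJ
  refine ⟨δ / 2 ^ (2 * J + 1), by positivity, max 5 ⌈((2 : ℝ) ^ 14) ^ (1 / δ)⌉₊, ?_⟩
  intro p _ hp hp₀ μ hμ0 hμ1 hμ hc φ hφ
  have : Fact p.Prime := ⟨hp⟩
  have hp5 : 5 ≤ p := (le_max_left _ _).trans hp₀
  have hp1 : (1 : ℝ) ≤ p := by exact_mod_cast (by omega : 1 ≤ p)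
  have hp0 : (0 : ℝ) < p := by linarith
  have hK : 2 ^ 14 ≤ (p : ℝ) ^ δ := by
    have h : ((2 : ℝ) ^ 14) ^ (1 / δ) ≤ p :=
      (Nat.le_ceil _).trans (by exact_mod_cast (le_max_right _ _).trans hp₀)
    calc (2 : ℝ) ^ 14 = (((2 : ℝ) ^ 14) ^ (1 / δ)) ^ δ := by
          rw [← Real.rpow_mul (by norm_num), one_div_mul_cancel hδ0.ne', Real.rpow_one]
      _ ≤ (p : ℝ) ^ δ := Real.rpow_le_rpow (by positivity) h hδ0.le
  have hpow : ∀ n : ℕ, ((p : ℝ) ^ δ) ^ n = (p : ℝ) ^ (n * δ) := fun n => by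
    rw [← Real.rpow_natCast, ← Real.rpow_mul hp0.le, mul_comm]
  have h2 : (2 : ZMod p) ≠ 0 := by
    intro h
    have h' : ((2 : ℕ) : ZMod p) = 0 := by exact_mod_cast h
    exact absurd (Nat.le_of_dvd two_pos ((ZMod.natCast_eq_zero_iff 2 p).1 h')) (by omega)
  have h3 : (3 : ZMod p) ≠ 0 := by
    intro h
    have h' : ((3 : ℕ) : ZMod p) = 0 := by exact_mod_cast h
    exact absurd (Nat.le_of_dvd three_pos ((ZMod.natCast_eq_zero_iff 3 p).1 h')) (by omega)
  have hKF : ((p : ℝ) ^ δ) ^ 737 ≤ Fintype.card (ZMod p) := by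
    rw [ZMod.card, hpow]
    exact (Real.rpow_le_rpow_of_exponent_le hp1 (by exact_mod_cast hδ1)).trans_eq
      (Real.rpow_one _)
  have hKc : ((p : ℝ) ^ δ) ^ 582 * (p : ℝ) ^ (-τ) ≤ 1 := by
    rw [hpow, ← Real.rpow_add hp0]
    refine Real.rpow_le_one_of_one_le_of_nonpos hp1 ?_
    push_cast
    linarith
  have hKJ : (Fintype.card (ZMod p) : ℝ) ^ 4 ≤ ((p : ℝ) ^ δ) ^ J := by
    rw [ZMod.card, hpow, ← Real.rpow_natCast]
    refine Real.rpow_le_rpow_of_exponent_le hp1 ?_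
    have h := Nat.le_ceil (4 / δ)
    rw [div_le_iff₀ hδ0] at h
    exact_mod_cast h
  have h := L2Flattening.l2Norm_convR_le_of_coset h2 h3 (ZMod.isPrimitive_stdAddChar p) hμ0 hμ1
    (fun x => (hμ x).le) (fun H hH b => (hc H hH b).le) hK hKF hKc hKJ hφ
  rwa [← Real.rpow_mul hp0.le, mul_neg, mul_one_div] at h
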